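/- arXiv:2107.06969 — 2 statements merged into one kernel-verified Lean document; each statement's English description precedes it below -/
import Mathlib

section
/- Let G = ⟨x, y | x^p = y^m = 1, x^{-1} y x = y^r⟩ where p is the smallest prime divisor of |G| and gcd(p(r-1), m) = 1. Then the small Davenport constant satisfies d(G) = m + p - 2. -/
/-- The set of products of a sequence (multiset) `S` over all orderings. -/
def piSet {G : Type*} [Group G] (S : Multiset G) : Set G :=
  {g | ∃ l : List G, (l : Multiset G) = S ∧ l.prod = g}

/-- The set `Π(S)` of all products of nonempty subsequences of `S`. -/
def subProds {G : Type*} [Group G] (S : Multiset G) : Set G :=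
  {g | ∃ T : Multiset G, T ≤ S ∧ T ≠ 0 ∧ g ∈ piSet T}

/-- The small Davenport constant: the maximal length of a product-one free sequence. -/
noncomputable def dG (G : Type*) [Group G] : ℕ :=
  sSup {n | ∃ S : Multiset G, Multiset.card S = n ∧ (1 : G) ∉ subProds S}

open scoped Pointwise in
/-- The Scherk–Kemperman bound: if `1 = a * b` has only the trivial solution, then
`|A| + |B| ≤ |A * B| + 1`. -/
theorem card_add_card_le_card_mul_add_one {G : Type*} [Group G] [Finite G] [DecidableEq G]
    (A B : Finset G) (hA : 1 ∈ A) (hB : 1 ∈ B)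
    (hcomm : ∀ b ∈ B, ∀ c ∈ B, b * c = c * b)
    (huniq : ∀ a ∈ A, ∀ b ∈ B, a * b = 1 → b = 1) :
    A.card + B.card ≤ (A * B).card + 1 := by
  induction hn : B.card using Nat.strong_induction_on generalizing A B with
  | _ n ih =>
  subst hn
  by_cases hB1 : ∃ b ∈ B, b ≠ 1
  · obtain ⟨b, hb, hb1⟩ := hB1
    have hex : ∃ a ∈ A, a * b ∉ A := by
      by_contra! h
      have hpow : ∀ k : ℕ, b ^ k ∈ A := by
        intro k
        induction k with
        | zero => simpa using hA
        | succ k ihk => rw [pow_succ]; exact h _ ihk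
      refine hb1 (huniq _ (hpow (orderOf b - 1)) b hb ?_)
      rw [← pow_succ, Nat.sub_add_cancel (orderOf_pos b), pow_orderOf_eq_one]
    obtain ⟨a, ha, hab⟩ := hex
    set C := B.filter (fun c => a * c ∉ A) with hC
    have hCB : C ⊆ B := Finset.filter_subset _ _
    have hbC : b ∈ C := Finset.mem_filter.2 ⟨hb, hab⟩
    have h1C : (1 : G) ∉ C := by simp [hC, ha]
    have hsdiff : ∀ c ∈ B \ C, c ∈ B ∧ a * c ∈ A := by
      intro c hc
      simp only [hC, Finset.mem_sdiff, Finset.mem_filter, not_and, not_not] at hc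
      exact ⟨hc.1, hc.2 hc.1⟩
    have hcardB : (B \ C).card + C.card = B.card := Finset.card_sdiff_add_card_eq_card hCB
    have hCpos : 0 < C.card := Finset.card_pos.2 ⟨b, hbC⟩
    have hdisj : Disjoint A (C.image (a * ·)) := by
      rw [Finset.disjoint_right]
      intro z hz
      obtain ⟨c, hc, rfl⟩ := Finset.mem_image.1 hz
      exact (Finset.mem_filter.1 hc).2
    have hcardA : (A ∪ C.image (a * ·)).card = A.card + C.card := by
      rw [Finset.card_union_of_disjoint hdisj,
        Finset.card_image_of_injective _ (mul_right_injective a)]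
    have hswap : ∀ c ∈ C, ∀ d ∈ B \ C, a * c * d = a * d * c := fun c hc d hd => by
      rw [mul_assoc, hcomm c (hCB hc) d (hsdiff d hd).1, mul_assoc]
    have key := ih (B \ C).card (by omega) (A ∪ C.image (a * ·)) (B \ C)
      (Finset.mem_union_left _ hA) (Finset.mem_sdiff.2 ⟨hB, h1C⟩)
      (fun c hc d hd => hcomm c (hsdiff c hc).1 d (hsdiff d hd).1)
      (by
        intro z hz d hd h1
        rcases Finset.mem_union.1 hz with hz | hz
        · exact huniq z hz d (hsdiff d hd).1 h1
        · obtain ⟨c, hc, rfl⟩ := Finset.mem_image.1 hz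
          rw [hswap c hc d hd] at h1
          exact absurd (huniq _ (hsdiff d hd).2 c (hCB hc) h1 ▸ hc) h1C) rfl
    have hsub : (A ∪ C.image (a * ·)) * (B \ C) ⊆ A * B := by
      intro w hw
      obtain ⟨z, hz, d, hd, rfl⟩ := Finset.mem_mul.1 hw
      rcases Finset.mem_union.1 hz with hz | hz
      · exact Finset.mul_mem_mul hz (hsdiff d hd).1
      · obtain ⟨c, hc, rfl⟩ := Finset.mem_image.1 hz
        simp only [hswap c hc d hd]
        exact Finset.mul_mem_mul (hsdiff d hd).2 (hCB hc)
    have := Finset.card_le_card hsub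
    omega
  · push Not at hB1
    have : B = {1} := Finset.eq_singleton_iff_unique_mem.2 ⟨hB, hB1⟩
    simp [this]

theorem subProds_mono {G : Type*} [Group G] {S T : Multiset G} (h : S ≤ T) :
    subProds S ⊆ subProds T := fun _ ⟨U, hU, hU0, hg⟩ => ⟨U, hU.trans h, hU0, hg⟩

theorem mul_mem_subProds_add {G : Type*} [Group G] {S T : Multiset G} {a b : G}
    (ha : a ∈ subProds S) (hb : b ∈ subProds T) : a * b ∈ subProds (S + T) := by
  obtain ⟨U, hU, hU0, l, rfl, rfl⟩ := ha
  obtain ⟨V, hV, -, k, rfl, rfl⟩ := hb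
  exact ⟨l + k, add_le_add hU hV, fun h => hU0 (by simp_all), l ++ k, by simp, by simp⟩

theorem prod_mem_subProds {G : Type*} [Group G] {S : Multiset G} {l : List G}
    (hl : (l : Multiset G) ≤ S) (h0 : l ≠ []) : l.prod ∈ subProds S :=
  ⟨l, hl, by simpa using h0, l, rfl, rfl⟩

theorem List.prod_drop_take {G : Type*} [Group G] (l : List G) {i j : ℕ} (hij : i ≤ j) :
    ((l.take j).drop i).prod = (l.take i).prod⁻¹ * (l.take j).prod := by
  rw [eq_inv_mul_iff_mul_eq, ← List.prod_append]
  conv_rhs => rw [← List.take_append_drop i (l.take j), List.take_take, min_eq_left hij]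

/-- A sequence of length at least the index of `N` has a nonempty subsequence with a product
in `N`. -/
theorem exists_prod_mem_of_index_le {G : Type*} [Group G] (N : Subgroup G) [N.FiniteIndex]
    {S : Multiset G} (hS : N.index ≤ Multiset.card S) :
    ∃ l : List G, (l : Multiset G) ≤ S ∧ l ≠ [] ∧ l.prod ∈ N := by
  have : Fintype (G ⧸ N) := Fintype.ofFinite _
  have hcard : Fintype.card (G ⧸ N) < Fintype.card (Fin (Multiset.card S + 1)) := by
    rw [← Nat.card_eq_fintype_card, ← Subgroup.index, Fintype.card_fin]
    omega
  obtain ⟨i, j, hne, hij⟩ := Fintype.exists_ne_map_eq_of_card_lt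
    (fun i : Fin (Multiset.card S + 1) => ((S.toList.take i).prod : G ⧸ N)) hcard
  wlog hlt : i < j generalizing i j
  · exact this j i hne.symm hij.symm (lt_of_le_of_ne (not_lt.1 hlt) hne.symm)
  refine ⟨(S.toList.take j).drop i, ?_, ?_, ?_⟩
  · conv_rhs => rw [← S.coe_toList]
    exact ((List.drop_sublist _ _).trans (List.take_sublist _ _)).subperm
  · have := j.2
    rw [← List.length_pos_iff]
    simp only [List.length_drop, List.length_take, Multiset.length_toList]
    omega
  · rw [List.prod_drop_take _ hlt.le]
    exact QuotientGroup.eq.1 hij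

theorem List.prod_rotate_eq_conj {G : Type*} [Group G] (l : List G) {i : ℕ}
    (hi : i ≤ l.length) :
    (l.rotate i).prod = (l.take i).prod⁻¹ * l.prod * (l.take i).prod := by
  rw [List.rotate_eq_drop_append_take hi, List.prod_append]
  conv_rhs => rw [← List.prod_take_mul_prod_drop l i]
  group

/-- A shortest sequence with product in `N`, that product being `≠ 1`, has at least as many
products in `N` as terms, provided that `N` is normal and contains the centralizers of its
nontrivial elements. -/
theorem length_le_ncard_subProds_inter {G : Type*} [Group G] [Finite G] (N : Subgroup G) [N.Normal]
    (hcent : ∀ g ∈ N, g ≠ 1 → ∀ c : G, c * g = g * c → c ∈ N) (l : List G)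
    (hl : l.prod ∈ N) (hl1 : l.prod ≠ 1)
    (hmin : ∀ k : List G, k.Sublist l → k ≠ [] → k.prod ∈ N → l.length ≤ k.length) :
    l.length ≤ (subProds (l : Multiset G) ∩ N).ncard := by
  have hl0 : l ≠ [] := by rintro rfl; simp at hl1
  let f : Fin l.length → G := fun i => (l.rotate i).prod
  have hlt : ∀ i j : Fin l.length, i < j → f i ≠ f j := by
    intro i j hij h
    simp only [f, List.prod_rotate_eq_conj l i.2.le, List.prod_rotate_eq_conj l j.2.le] at h
    have hmem : (l.take j).prod * (l.take i).prod⁻¹ ∈ N := by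
      refine hcent _ hl hl1 _ ?_
      have := congrArg (fun z => (l.take j).prod * z * (l.take i).prod⁻¹) h
      simpa [mul_assoc] using this
    have hmem' : ((l.take j).drop i).prod ∈ N := by
      rw [List.prod_drop_take l hij.le]
      exact Subgroup.Normal.mem_comm ‹_› hmem
    have hj := j.2
    have hij' : (i : ℕ) < j := hij
    have hlen : ((l.take j).drop i).length = j - i := by
      simp only [List.length_drop, List.length_take]
      omega
    have := hmin ((l.take j).drop i) ((List.drop_sublist _ _).trans (List.take_sublist _ _))
      (by rw [← List.length_pos_iff]; omega) hmem'
    omega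
  have hinj : Function.Injective f := by
    intro i j h
    by_contra hne
    rcases lt_or_gt_of_ne hne with h' | h'
    · exact hlt i j h' h
    · exact hlt j i h' h.symm
  have hrange : Set.range f ⊆ subProds (l : Multiset G) ∩ N := by
    rintro _ ⟨i, rfl⟩
    refine ⟨prod_mem_subProds (List.rotate_perm l i).subperm ?_, ?_⟩
    · simpa using hl0
    · simp only [f, List.prod_rotate_eq_conj l i.2.le]
      simpa using Subgroup.Normal.conj_mem ‹_› _ hl (l.take i).prod⁻¹
  calc l.length = (Set.range f).ncard := by
        rw [← Set.image_univ, Set.ncard_image_of_injective _ hinj, Set.ncard_univ, Nat.card_fin]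
    _ ≤ _ := Set.ncard_le_ncard hrange (Set.toFinite _)

open scoped Pointwise in
/-- A product-one free sequence is bounded in length by the number of its products in `N` and
the index of `N`. -/
theorem card_le_ncard_subProds_inter_add_index {G : Type*} [Group G] [Finite G]
    (N : Subgroup G) [N.Normal] (hab : ∀ a ∈ N, ∀ b ∈ N, a * b = b * a)
    (hcent : ∀ g ∈ N, g ≠ 1 → ∀ c : G, c * g = g * c → c ∈ N) (S : Multiset G)
    (hS : (1 : G) ∉ subProds S) :
    Multiset.card S + 1 ≤ (subProds S ∩ N).ncard + N.index := by
  classical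
  induction hn : Multiset.card S using Nat.strong_induction_on generalizing S with
  | _ n ih =>
  subst hn
  by_cases hlt : Multiset.card S < N.index
  · omega
  have hex : ∃ k, ∃ l : List G, ((l : Multiset G) ≤ S ∧ l ≠ [] ∧ l.prod ∈ N) ∧ l.length = k := by
    obtain ⟨l, hl⟩ := exists_prod_mem_of_index_le N (not_lt.1 hlt)
    exact ⟨_, l, hl, rfl⟩
  obtain ⟨l, ⟨hlS, hl0, hlN⟩, hlen⟩ := Nat.find_spec hex
  have hmin : ∀ k : List G, k.Sublist l → k ≠ [] → k.prod ∈ N → l.length ≤ k.length := by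
    intro k hk hk0 hkN
    rw [hlen]
    exact Nat.find_min' hex ⟨k, ⟨le_trans hk.subperm hlS, hk0, hkN⟩, rfl⟩
  have hl1 : l.prod ≠ 1 := fun h => hS (h ▸ prod_mem_subProds hlS hl0)
  have hT := length_le_ncard_subProds_inter N hcent l hlN hl1 hmin
  obtain ⟨R, rfl⟩ := Multiset.le_iff_exists_add.1 hlS
  have hlpos := List.length_pos_iff.2 hl0
  have hRS : subProds R ⊆ subProds ((l : Multiset G) + R) :=
    subProds_mono (Multiset.le_add_left _ _)
  have hTS : subProds (l : Multiset G) ⊆ subProds ((l : Multiset G) + R) :=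
    subProds_mono (Multiset.le_add_right _ _)
  have hR := ih (Multiset.card R) (by simp; omega) R (fun h => hS (hRS h)) rfl
  let F : Multiset G → Finset G := fun U => (insert (1 : G) (subProds U ∩ N)).toFinite.toFinset
  have hF : ∀ U g, g ∈ F U ↔ g = 1 ∨ g ∈ subProds U ∧ g ∈ N := by simp [F]
  have hcard : ∀ U : Multiset G, (1 : G) ∉ subProds U →
      (F U).card = (subProds U ∩ N).ncard + 1 := by
    intro U hU
    rw [← Set.ncard_eq_toFinset_card, Set.ncard_insert_of_notMem (fun h => hU h.1)]
  have hmul : ∀ a ∈ subProds R, ∀ b ∈ subProds (l : Multiset G),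
      a * b ∈ subProds ((l : Multiset G) + R) := by
    intro a ha b hb
    rw [add_comm]
    exact mul_mem_subProds_add ha hb
  have key := card_add_card_le_card_mul_add_one (F R) (F l) (by simp [hF]) (by simp [hF])
    (by
      intro b hb c hc
      rcases (hF _ _).1 hb with rfl | hb
      · simp
      rcases (hF _ _).1 hc with rfl | hc
      · simp
      exact hab _ hb.2 _ hc.2)
    (by
      intro a ha b hb h
      rcases (hF _ _).1 hb with hb | hb
      · exact hb
      rcases (hF _ _).1 ha with rfl | ha
      · simpa using h
      exact absurd (h ▸ hmul a ha.1 b hb.1) hS)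
  have hle : (F R * F l).card ≤ (F (l + R)).card := by
    refine Finset.card_le_card fun z hz => ?_
    obtain ⟨a, ha, b, hb, rfl⟩ := Finset.mem_mul.1 hz
    rw [hF]
    rcases (hF _ _).1 hb with rfl | hb
    · rw [mul_one]
      exact ((hF _ _).1 ha).imp_right fun h => ⟨hRS h.1, h.2⟩
    · rcases (hF _ _).1 ha with rfl | ha
      · rw [one_mul]
        exact Or.inr ⟨hTS hb.1, hb.2⟩
      · exact Or.inr ⟨hmul a ha.1 b hb.1, N.mul_mem ha.2 hb.2⟩
  rw [hcard R (fun h => hS (hRS h)), hcard _ (fun h => hS (hTS h))] at key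
  rw [hcard _ hS] at hle
  simp only [Multiset.card_add, Multiset.coe_card]
  omega

theorem one_notMem_subProds_replicate {G : Type*} [Group G] {x y : G} (N : Subgroup G)
    [N.Normal] {p : ℕ} (hp : 0 < p) (hx : orderOf (x : G ⧸ N) = p) (hy : y ∈ N)
    (hy0 : 0 < orderOf y) (hxN : x ∉ N) :
    (1 : G) ∉ subProds (Multiset.replicate (orderOf y - 1) y + Multiset.replicate (p - 1) x) := by
  classical
  rintro ⟨T, hT, hT0, l, rfl, hl⟩
  have hxy : x ≠ y := fun h => hxN (h ▸ hy)
  have hcx : l.count x ≤ p - 1 := by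
    simpa [Multiset.count_replicate, hxy.symm] using Multiset.count_le_of_le x hT
  have hcy : l.count y ≤ orderOf y - 1 := by
    simpa [Multiset.count_replicate, hxy] using Multiset.count_le_of_le y hT
  have hmem : ∀ z ∈ l, z = x ∨ z = y := by
    intro z hz
    have := Multiset.mem_of_le hT (Multiset.mem_coe.2 hz)
    rcases Multiset.mem_add.1 this with h | h
    · exact Or.inr (Multiset.eq_of_mem_replicate h)
    · exact Or.inl (Multiset.eq_of_mem_replicate h)
  have hprod : ∀ k : List G, (∀ z ∈ k, z = x ∨ z = y) →
      ((k.prod : G) : G ⧸ N) = (x : G ⧸ N) ^ k.count x := by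
    intro k
    induction k with
    | nil => simp
    | cons a k ih =>
      intro hk
      have ihk := ih fun z hz => hk z (List.mem_cons_of_mem _ hz)
      rcases hk a List.mem_cons_self with rfl | rfl
      · rw [List.prod_cons, QuotientGroup.mk_mul, ihk, List.count_cons_self, pow_succ']
      · rw [List.prod_cons, QuotientGroup.mk_mul, ihk, List.count_cons_of_ne hxy.symm,
          (QuotientGroup.eq_one_iff _).2 hy, one_mul]
  have hdvd : p ∣ l.count x := by
    rw [← hx]
    apply orderOf_dvd_of_pow_eq_one
    rw [← hprod l hmem, hl, QuotientGroup.mk_one]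
  have hcx0 : l.count x = 0 := Nat.eq_zero_of_dvd_of_lt hdvd (by omega)
  have hrep : l = List.replicate l.length y := by
    refine List.eq_replicate_iff.2 ⟨rfl, fun z hz => (hmem z hz).resolve_left ?_⟩
    rintro rfl
    exact List.count_eq_zero.1 hcx0 hz
  have hlen : l.length ≤ orderOf y - 1 := by
    rw [hrep, List.count_replicate_self] at hcy
    exact hcy
  rw [hrep, List.prod_replicate] at hl
  have := Nat.eq_zero_of_dvd_of_lt (orderOf_dvd_of_pow_eq_one hl) (by omega)
  exact hT0 (by simpa using this)

theorem stmt_10 (p m r : ℕ) (G : Type*) [Group G] [Fintype G] (x y : G)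
    (hp : p.Prime) (hm : 0 < m) (hr : 0 < r)
    (hcard : Fintype.card G = p * m)
    (hox : orderOf x = p) (hoy : orderOf y = m)
    (hrel : x⁻¹ * y * x = y ^ r)
    (hgen : Subgroup.closure ({x, y} : Set G) = ⊤)
    (hpmin : ∀ q : ℕ, q.Prime → q ∣ p * m → p ≤ q)
    (hgcd : Nat.gcd (p * (r - 1)) m = 1) :
    dG G = m + p - 2 := by
  set N := Subgroup.zpowers y with hN
  have hyN : y ∈ N := Subgroup.mem_zpowers y
  have hindex : N.index = p := by
    have h := N.card_mul_index
    rw [Nat.card_zpowers, hoy, Nat.card_eq_fintype_card, hcard, mul_comm p m] at h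
    exact Nat.eq_of_mul_eq_mul_left hm h
  have hpm : p * m ≠ 1 := fun h => hp.one_lt.ne' (Nat.eq_one_of_mul_eq_one_right h)
  have : N.Normal := by
    apply Subgroup.normal_of_index_eq_minFac_card
    rw [hindex, Nat.card_eq_fintype_card, hcard]
    exact le_antisymm (hpmin _ (Nat.minFac_prime hpm) (Nat.minFac_dvd _))
      (Nat.minFac_le_of_dvd hp.two_le (dvd_mul_right _ _))
  have hab : ∀ a ∈ N, ∀ b ∈ N, a * b = b * a := by
    rintro _ ⟨i, rfl⟩ _ ⟨j, rfl⟩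
    exact zpow_mul_comm y i j
  have hcent : ∀ g ∈ N, g ≠ 1 → ∀ c : G, c * g = g * c → c ∈ N := by
    intro g hg hg1 c hc
    have hNC : N ≤ Subgroup.centralizer {g} := fun a ha =>
      Subgroup.mem_centralizer_singleton_iff.2 (hab _ ha _ hg)
    have hmul := Subgroup.relIndex_mul_index hNC
    rw [hindex] at hmul
    rcases (Nat.dvd_prime hp).1 (Dvd.intro _ hmul) with h | h
    · exact Subgroup.relIndex_eq_one.1 h (Subgroup.mem_centralizer_singleton_iff.2 hc)
    · have htop : Subgroup.centralizer {g} = ⊤ := by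
        rw [← Subgroup.index_eq_one]
        rw [h] at hmul
        exact Nat.eq_of_mul_eq_mul_left hp.pos (by simpa using hmul)
      have hx : x * g = g * x := Subgroup.mem_centralizer_singleton_iff.1
        (htop ▸ Subgroup.mem_top x)
      refine absurd ?_ hg1
      obtain ⟨k, rfl⟩ := hg
      simp only at hx
      have hconj : (y ^ k) ^ r = y ^ k := by
        calc (y ^ k) ^ r = (x⁻¹ * y * x) ^ k := by
              rw [hrel, ← zpow_natCast, ← zpow_natCast, ← zpow_mul, ← zpow_mul, mul_comm]
          _ = x⁻¹ * y ^ k * x := by simpa using (conj_zpow (a := x⁻¹) (b := y) (i := k))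
          _ = y ^ k := by rw [mul_assoc, ← hx, inv_mul_cancel_left]
      have h1 : (y ^ k) ^ (r - 1) = 1 := by
        apply mul_right_cancel (b := y ^ k)
        rw [← pow_succ, Nat.sub_add_cancel hr, hconj, one_mul]
      have h2 : (y ^ k) ^ m = 1 := by
        rw [← hoy, ← zpow_natCast, ← zpow_mul, mul_comm, zpow_mul, zpow_natCast,
          pow_orderOf_eq_one, one_zpow]
      have hcop : Nat.gcd (r - 1) m = 1 := Nat.Coprime.coprime_mul_left hgcd
      have := orderOf_dvd_of_pow_eq_one h1
      rw [← orderOf_eq_one_iff, ← Nat.dvd_one, ← hcop]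
      exact Nat.dvd_gcd this (orderOf_dvd_of_pow_eq_one h2)
  have hxN : x ∉ N := by
    intro hx
    have : N = ⊤ := by
      rw [eq_top_iff, ← hgen, Subgroup.closure_le]
      rintro z (rfl | rfl)
      exacts [hx, hyN]
    rw [this, Subgroup.index_top] at hindex
    exact hp.one_lt.ne hindex
  have hoxN : orderOf (x : G ⧸ N) = p := by
    have : Fact p.Prime := ⟨hp⟩
    apply orderOf_eq_prime
    · rw [← QuotientGroup.mk_pow, ← hox, pow_orderOf_eq_one, QuotientGroup.mk_one]
    · rwa [Ne, QuotientGroup.eq_one_iff]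
  have hp1 := hp.one_lt
  refine IsGreatest.csSup_eq ⟨⟨_, ?_, one_notMem_subProds_replicate N hp.pos hoxN hyN
    (orderOf_pos y) hxN⟩, ?_⟩
  · simp only [Multiset.card_add, Multiset.card_replicate, hoy]
    omega
  · rintro _ ⟨S, rfl, hS⟩
    have h := card_le_ncard_subProds_inter_add_index N hab hcent S hS
    have hss : subProds S ∩ N ⊂ (N : Set G) :=
      ⟨Set.inter_subset_right, fun h => hS (h N.one_mem).1⟩
    have hlt := Set.ncard_lt_ncard hss (Set.toFinite _)
    have hcardN : (N : Set G).ncard = m := by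
      rw [← hoy, ← Nat.card_zpowers]
      rfl
    omega
end

section
/- Let G = ⟨x, y | x^p = y^m = 1, x^{-1} y x = y^r⟩ where p is the smallest prime divisor of |G| and gcd(p(r-1), m) = 1. Then E(G) = d(G) + |G| = pm + m + p - 2, where E(G) is the smallest integer t such that every sequence of t elements of G contains a subsequence of length |G| whose elements in some order multiply to 1. -/
/-- `E(G)`: the least `t` such that every sequence of length `t` over `G` has a
product-one subsequence of length `|G|`. -/
noncomputable def EG (G : Type*) [Group G] [Fintype G] : ℕ :=
  sInf {t | ∀ S : Multiset G, Multiset.card S = t →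
    ∃ T, T ≤ S ∧ Multiset.card T = Fintype.card G ∧ (1 : G) ∈ piSet T}

section

open Finset Pointwise

theorem card_mul_of_unique_one {A : Type*} [CommGroup A] [DecidableEq A] (B : Finset A) :
    ∀ X : Finset A, 1 ∈ X → 1 ∈ B → (∀ a ∈ X, ∀ b ∈ B, a * b = 1 → a = 1) →
      #X + #B ≤ #(X * B) + 1 := by
  induction hn : #B using Nat.strong_induction_on generalizing B with
  | _ n ih =>
  subst hn
  intro X hX hB h
  by_cases hc : ∃ a ∈ X, ∃ b ∈ B, a * b ∉ X
  · obtain ⟨a, ha, b, hb, hab⟩ := hc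
    set B' := B.filter (fun b => a * b ∈ X) with hB'
    set X' := X ∪ (B.filter (fun b => a * b ∉ X)).image (fun b => a * b) with hX'
    have hlt : #B' < #B := by
      apply card_lt_card
      refine ⟨filter_subset _ _, fun hs => hab ?_⟩
      have := hs hb
      exact (mem_filter.1 this).2
    have hcardX' : #X' = #X + #(B.filter (fun b => a * b ∉ X)) := by
      rw [hX', card_union_of_disjoint, card_image_of_injective _ (mul_right_injective a)]
      rw [disjoint_right]
      intro z hz
      obtain ⟨b, hb, rfl⟩ := mem_image.1 hz
      exact (mem_filter.1 hb).2
    have hsum : #B' + #(B.filter (fun b => a * b ∉ X)) = #B :=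
      card_filter_add_card_filter_not _
    have hsub : X' * B' ⊆ X * B := by
      intro z hz
      obtain ⟨x, hx, b', hb', rfl⟩ := mem_mul.1 hz
      have hb2 := mem_filter.1 hb'
      rcases mem_union.1 hx with hx | hx
      · exact mul_mem_mul hx hb2.1
      · obtain ⟨b, hb, rfl⟩ := mem_image.1 hx
        have : a * b * b' = (a * b') * b := by
          rw [mul_assoc, mul_comm b, mul_assoc]
        rw [this]
        exact mul_mem_mul hb2.2 (mem_filter.1 hb).1
    have key := ih #B' hlt B' rfl X' (mem_union_left _ hX) (mem_filter.2 ⟨hB, by simpa using ha⟩)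
      (by
        intro x hx b' hb' hxb
        have hb2 := mem_filter.1 hb'
        rcases mem_union.1 hx with hx | hx
        · exact h x hx b' hb2.1 hxb
        · obtain ⟨b, hb, rfl⟩ := mem_image.1 hx
          have e1 : a * b' * b = 1 := by
            rw [← hxb, mul_assoc, mul_comm b', mul_assoc]
          have e2 := h _ hb2.2 b (mem_filter.1 hb).1 e1
          have e3 := h a ha b' hb2.1 e2
          have : b = 1 := by simpa [e2] using e1
          simp [e3, this])
    have := card_le_card hsub
    omega
  · push Not at hc
    have hB1 : B ⊆ {1} := by
      intro b hb
      have himg : X.image (fun a => a * b) = X := by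
        apply eq_of_subset_of_card_le
        · intro z hz
          obtain ⟨a, ha, rfl⟩ := mem_image.1 hz
          exact hc a ha b hb
        · rw [card_image_of_injective _ (mul_left_injective b)]
      rw [← himg] at hX
      obtain ⟨a, ha, hab⟩ := mem_image.1 hX
      have := h a ha b hb hab
      subst this
      simpa using hab
    have : B = {1} := Subset.antisymm hB1 (by simpa using hB)
    subst this
    simp

/-- The finset of products of subfamilies of `c` indexed by subsets of `J`. -/
def subsetProds {ι A : Type*} [CommGroup A] [DecidableEq A] (c : ι → A) (J : Finset ι) :
    Finset A := J.powerset.image fun T => ∏ i ∈ T, c i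

theorem mem_subsetProds {ι A : Type*} [CommGroup A] [DecidableEq A] {c : ι → A} {J : Finset ι}
    {a : A} : a ∈ subsetProds c J ↔ ∃ T ⊆ J, ∏ i ∈ T, c i = a := by
  simp [subsetProds]

theorem subsetProds_cover {ι A : Type*} [CommGroup A] [Finite A]
    (c : ι → A) (J : Finset ι) (K : Subgroup A) (hcK : ∀ j ∈ J, c j ∈ K) (hc1 : ∀ j ∈ J, c j ≠ 1)
    (hJ : Nat.card K ≤ #J + 1)
    (hL : ∀ L : Subgroup A, L < K → L ≠ ⊥ → ∀ I ⊆ J, (∀ i ∈ I, c i ∈ L) → #I + 1 < Nat.card L) :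
    ∀ k ∈ K, ∃ T ⊆ J, ∏ i ∈ T, c i = k := by
  classical
  have := Fintype.ofFinite A
  set Kf : Finset A := univ.filter (· ∈ K) with hKf
  have hKcard : ∀ L : Subgroup A, Nat.card L = #(univ.filter (· ∈ L)) := by
    intro L
    rw [Nat.card_eq_fintype_card, Fintype.card_subtype]
  have hsubK : ∀ J' ⊆ J, subsetProds c J' ⊆ Kf := by
    intro J' hJ' a ha
    obtain ⟨T, hT, rfl⟩ := mem_subsetProds.1 ha
    simp only [hKf, mem_filter, mem_univ, true_and]
    exact Subgroup.prod_mem _ fun i hi => hcK i (hJ' (hT hi))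
  obtain ⟨J', hJ'mem, hmax⟩ := exists_max_image
    (J.powerset.filter fun J' => #J' + 1 ≤ #(subsetProds c J')) (fun J' => #J')
    ⟨∅, by simp [subsetProds]⟩
  rw [mem_filter, mem_powerset] at hJ'mem
  obtain ⟨hJ'J, hJ'c⟩ := hJ'mem
  set X := subsetProds c J' with hX
  by_cases hXK : #Kf ≤ #X
  · have hXeq : X = Kf := eq_of_subset_of_card_le (hsubK J' hJ'J) hXK
    intro k hk
    have : k ∈ X := by rw [hXeq]; simpa [hKf] using hk
    obtain ⟨T, hT, h⟩ := mem_subsetProds.1 this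
    exact ⟨T, hT.trans hJ'J, h⟩
  exfalso
  push Not at hXK
  have h1X : (1 : A) ∈ X := mem_subsetProds.2 ⟨∅, by simp, by simp⟩
  obtain ⟨L, hLdef⟩ : ∃ L : Subgroup A, L = MulAction.stabilizer A X := ⟨_, rfl⟩
  have hXsub : X ⊆ Kf := hsubK J' hJ'J
  have hKc : Nat.card K = #Kf := hKcard K
  have hstab : ∀ j ∈ J \ J', c j ∈ L := by
    intro j hj
    rw [mem_sdiff] at hj
    rw [hLdef, MulAction.mem_stabilizer_iff]
    have hins : X ∪ c j • X ⊆ subsetProds c (insert j J') := by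
      intro a ha
      rcases mem_union.1 ha with ha | ha
      · obtain ⟨T, hT, rfl⟩ := mem_subsetProds.1 ha
        exact mem_subsetProds.2 ⟨T, hT.trans (subset_insert _ _), rfl⟩
      · obtain ⟨b, hb, rfl⟩ := mem_smul_finset.1 ha
        obtain ⟨T, hT, rfl⟩ := mem_subsetProds.1 hb
        refine mem_subsetProds.2 ⟨insert j T, insert_subset_insert _ hT, ?_⟩
        rw [prod_insert (fun h => hj.2 (hT h)), smul_eq_mul]
    have hle : #(subsetProds c (insert j J')) ≤ #J' + 1 := by
      by_contra hcon
      push Not at hcon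
      have := hmax (insert j J') (by
        rw [mem_filter, mem_powerset, card_insert_of_notMem hj.2]
        exact ⟨insert_subset hj.1 hJ'J, by omega⟩)
      simp only [card_insert_of_notMem hj.2] at this
      omega
    have h1 : X ∪ c j • X = X :=
      (eq_of_subset_of_card_le subset_union_left (by
        have := card_le_card hins
        omega)).symm
    refine eq_of_subset_of_card_le (union_eq_left.1 h1) ?_
    rw [card_smul_finset]
  have hLK : L ≤ K := by
    intro l hl
    rw [hLdef, MulAction.mem_stabilizer_iff] at hl
    have : l • (1 : A) ∈ l • X := smul_mem_smul_finset h1X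
    rw [hl] at this
    have := hsubK J' hJ'J this
    simpa [hKf] using this
  have hLX : (univ.filter (· ∈ L)) ⊆ X := by
    intro l hl
    simp only [mem_filter, mem_univ, true_and] at hl
    rw [hLdef, MulAction.mem_stabilizer_iff] at hl
    have : l • (1 : A) ∈ l • X := smul_mem_smul_finset h1X
    rw [hl] at this
    simpa using this
  have hLlt : L < K := by
    refine lt_of_le_of_ne hLK fun h => ?_
    have := card_le_card hLX
    rw [← hKcard, h] at this
    omega
  have hne : (J \ J').Nonempty := by
    rw [nonempty_iff_ne_empty]
    intro h
    have := card_le_card (sdiff_eq_empty_iff_subset.1 h)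
    omega
  obtain ⟨j, hj⟩ := hne
  have hLbot : L ≠ ⊥ := by
    intro h
    have := hstab j hj
    rw [h, Subgroup.mem_bot] at this
    exact hc1 j (mem_sdiff.1 hj).1 this
  have hfin := hL L hLlt hLbot (J \ J') sdiff_subset hstab
  rw [card_sdiff_of_subset hJ'J] at hfin
  -- a coset of `L` avoids `X`
  obtain ⟨z, hzK, hzX⟩ := exists_of_ssubset
    (ssubset_of_subset_of_ne hXsub fun h => by
      have := congrArg card h
      omega)
  have hdis : z • (univ.filter (· ∈ L)) ⊆ Kf \ X := by
    intro w hw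
    obtain ⟨l, hl, rfl⟩ := mem_smul_finset.1 hw
    simp only [mem_filter, mem_univ, true_and] at hl
    have hzK' : z ∈ K := by simpa [hKf] using hzK
    rw [mem_sdiff]
    refine ⟨by simpa [hKf] using K.mul_mem hzK' (hLK hl), fun hzl => hzX ?_⟩
    have hl' := L.inv_mem hl
    rw [hLdef, MulAction.mem_stabilizer_iff] at hl'
    have : l⁻¹ • (z • l) ∈ l⁻¹ • X := smul_mem_smul_finset hzl
    rw [hl'] at this
    simpa [smul_eq_mul, mul_comm] using this
  have h1 := card_le_card hdis
  rw [card_smul_finset, card_sdiff_of_subset hXsub, ← hKcard L] at h1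
  omega

/-- A family of `|A| - 1` nontrivial elements contains a subfamily of `|K| - 1` elements of some
nontrivial subgroup `K` whose subset products exhaust `K`; this only depends on the subgroups that
the elements belong to. -/
theorem exists_subgroup_cover {ι A : Type*} [CommGroup A] [Finite A]
    (c : ι → A) (I : Finset ι) (hc1 : ∀ j ∈ I, c j ≠ 1) (hA : 2 ≤ Nat.card A)
    (hI : Nat.card A ≤ #I + 1) :
    ∃ K : Subgroup A, K ≠ ⊥ ∧ ∃ J ⊆ I, #J + 1 = Nat.card K ∧ (∀ j ∈ J, c j ∈ K) ∧
      ∀ c' : ι → A, (∀ j ∈ J, ∀ L : Subgroup A, c' j ∈ L ↔ c j ∈ L) →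
        ∀ k ∈ K, ∃ T ⊆ J, ∏ i ∈ T, c' i = k := by
  classical
  let P : Set (Subgroup A) := {K | K ≠ ⊥ ∧ Nat.card K ≤ #(I.filter (fun i => c i ∈ K)) + 1}
  have hP : (⊤ : Subgroup A) ∈ P := by
    refine ⟨?_, ?_⟩
    · intro h
      have : Nat.card (⊤ : Subgroup A) = 1 := by rw [h]; simp
      rw [Subgroup.card_top] at this
      omega
    · simpa using hI
  obtain ⟨K, hK⟩ := (Set.toFinite P).exists_minimal ⟨_, hP⟩
  obtain ⟨J, hJ, hJc⟩ := exists_subset_card_eq (n := Nat.card K - 1)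
    (s := I.filter (fun i => c i ∈ K)) (by have := hK.1.2; omega)
  have hKpos : 0 < Nat.card K := Nat.card_pos
  refine ⟨K, hK.1.1, J, hJ.trans (filter_subset _ _), by omega,
    fun j hj => (mem_filter.1 (hJ hj)).2, fun c' hc' => ?_⟩
  have hJI : J ⊆ I := hJ.trans (filter_subset _ _)
  apply subsetProds_cover
  · intro j hj
    exact (hc' j hj K).2 (mem_filter.1 (hJ hj)).2
  · intro j hj h
    exact hc1 j (hJI hj) ((Subgroup.mem_bot).1 ((hc' j hj ⊥).1 (by simp [h])))
  · omega
  · intro L hLK hLb S hS hSL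
    by_contra hcon
    push Not at hcon
    refine hLK.not_ge (hK.2 ⟨hLb, hcon.trans ?_⟩ hLK.le)
    refine Nat.succ_le_succ (card_le_card fun i hi => ?_)
    exact mem_filter.2 ⟨hJI (hS hi), (hc' i (hS hi) L).1 (hSL i hi)⟩

open scoped Classical in
/-- The union of the pairs in `P`. -/
noncomputable def pairSupp {ι : Type*} (P : Finset (ι × ι)) : Finset ι :=
  P.biUnion fun e => {e.1, e.2}

open scoped Classical in
/-- The pairs in `P` are disjoint and have distinct entries. -/
def DisjPairs {ι : Type*} (P : Finset (ι × ι)) : Prop :=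
  (∀ e ∈ P, e.1 ≠ e.2) ∧ (P : Set (ι × ι)).PairwiseDisjoint fun e => ({e.1, e.2} : Finset ι)

section
open scoped Classical

theorem DisjPairs.subset {ι : Type*} {P Q : Finset (ι × ι)} (h : DisjPairs P) (hQ : Q ⊆ P) :
    DisjPairs Q :=
  ⟨fun e he => h.1 e (hQ he), h.2.subset (by exact_mod_cast hQ)⟩

theorem DisjPairs.card_pairSupp {ι : Type*} {P : Finset (ι × ι)} (h : DisjPairs P) :
    #(pairSupp P) = 2 * #P := by
  rw [pairSupp, card_biUnion h.2, sum_congr rfl (fun e he => card_pair (h.1 e he))]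
  simp [mul_comm]

theorem pairSupp_mono {ι : Type*} {P Q : Finset (ι × ι)} (hQ : Q ⊆ P) :
    pairSupp Q ⊆ pairSupp P := biUnion_subset_biUnion_of_subset_left _ hQ

theorem mem_pairSupp {ι : Type*} {P : Finset (ι × ι)} {i : ι} :
    i ∈ pairSupp P ↔ ∃ e ∈ P, i = e.1 ∨ i = e.2 := by
  simp [pairSupp]

theorem pairSupp_insert {ι : Type*} (P : Finset (ι × ι)) (e : ι × ι) :
    pairSupp (insert e P) = {e.1, e.2} ∪ pairSupp P := by
  simp [pairSupp]

theorem DisjPairs.insert {ι : Type*} {P : Finset (ι × ι)} (h : DisjPairs P) {e : ι × ι}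
    (he : e.1 ≠ e.2) (h1 : e.1 ∉ pairSupp P) (h2 : e.2 ∉ pairSupp P) :
    DisjPairs (insert e P) := by
  constructor
  · intro e' he'
    rcases mem_insert.1 he' with rfl | he'
    · exact he
    · exact h.1 e' he'
  · rw [coe_insert]
    refine h.2.insert fun e' he' _ => ?_
    rw [disjoint_left]
    intro i hi hi'
    have hi2 : i ∈ pairSupp P := mem_pairSupp.2 ⟨e', he', by simpa using hi'⟩
    rcases mem_insert.1 hi with rfl | hi
    · exact h1 hi2
    · rw [mem_singleton] at hi
      exact h2 (hi ▸ hi2)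

theorem DisjPairs.of_insert {ι : Type*} {P : Finset (ι × ι)} {e : ι × ι}
    (h : DisjPairs (Insert.insert e P)) (he : e ∉ P) :
    DisjPairs P ∧ e.1 ≠ e.2 ∧ Disjoint ({e.1, e.2} : Finset ι) (pairSupp P) := by
  refine ⟨h.subset (subset_insert _ _), h.1 e (mem_insert_self _ _), ?_⟩
  rw [pairSupp, disjoint_biUnion_right]
  intro e' hmem
  exact h.2 (by simp) (by simp [hmem]) (fun h => he (h ▸ hmem))

/-- If no colour class misses fewer than `t` elements of `V` and `2 * t ≤ #V`, then there are `t`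
disjoint bichromatic pairs in `V`. -/
theorem exists_pairs {ι κ : Type*} (col : ι → κ) (t : ℕ) :
    ∀ V : Finset ι, 2 * t ≤ #V → (∀ c, t ≤ #(V.filter fun i => col i ≠ c)) →
      ∃ P : Finset (ι × ι), DisjPairs P ∧ #P = t ∧ pairSupp P ⊆ V ∧
        ∀ e ∈ P, col e.1 ≠ col e.2 := by
  induction t with
  | zero =>
    intro V _ _
    exact ⟨∅, by simp [DisjPairs], by simp, by simp [pairSupp], by simp⟩
  | succ t ih =>
    intro V hV hc
    obtain ⟨u, hu, hmax⟩ := exists_max_image V (fun i => #(V.filter fun j => col j = col i))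
      (card_pos.1 (by omega))
    obtain ⟨v, hv⟩ := card_pos.1 (lt_of_lt_of_le (Nat.succ_pos t) (hc (col u)))
    rw [mem_filter] at hv
    obtain ⟨hvV, huv⟩ := hv
    have hne : u ≠ v := fun h => huv (h ▸ rfl)
    have hsub : ({u, v} : Finset ι) ⊆ V := by
      intro i hi
      simp only [mem_insert, mem_singleton] at hi
      rcases hi with rfl | rfl <;> assumption
    have hcard : #(V \ {u, v}) + 2 = #V := by
      rw [← card_pair hne]
      exact card_sdiff_add_card_eq_card hsub
    obtain ⟨P, hP, hPt, hPV, hPc⟩ := ih (V \ {u, v}) (by omega) (by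
      intro c
      have hf : #(V.filter fun i => col i ≠ c) ≤
          #((V \ {u, v}).filter fun i => col i ≠ c) +
            #(({u, v} : Finset ι).filter fun i => col i ≠ c) := by
        rw [← card_union_of_disjoint
          (disjoint_filter_filter sdiff_disjoint)]
        apply card_le_card
        intro i hi
        rw [mem_filter] at hi
        simp only [mem_union, mem_filter, mem_sdiff]
        tauto
      have hcc := hc c
      by_cases h1 : col u = c
      · have : #(({u, v} : Finset ι).filter fun i => col i ≠ c) ≤ 1 := by
          rw [filter_insert, if_neg (by simpa using h1)]
          exact (card_filter_le _ _).trans (by simp)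
        omega
      by_cases h2 : col v = c
      · have : #(({u, v} : Finset ι).filter fun i => col i ≠ c) ≤ 1 := by
          have : (({u, v} : Finset ι).filter fun i => col i ≠ c) ⊆ {u} := by
            intro i hi
            simp only [mem_filter, mem_insert, mem_singleton] at hi ⊢
            rcases hi with ⟨rfl | rfl, h⟩
            · rfl
            · exact absurd h2 h
          simpa using card_le_card this
        omega
      have h2' : #(({u, v} : Finset ι).filter fun i => col i ≠ c) ≤ 2 :=
        (card_filter_le _ _).trans (card_le_two)
      have hle : #(V.filter fun j => col j = c) ≤ #(V.filter fun j => col j = col u) := by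
        by_cases hcV : ∃ i ∈ V, col i = c
        · obtain ⟨i, hi, rfl⟩ := hcV
          exact hmax i hi
        · have : (V.filter fun j => col j = c) = ∅ := by
            rw [filter_eq_empty_iff]
            intro i hi h
            exact hcV ⟨i, hi, h⟩
          simp [this]
      have hsum : #(V.filter fun j => col j = c) + #(V.filter fun j => col j = col u) + 1 ≤
          #V := by
        have hd : Disjoint (V.filter fun j => col j = c) (V.filter fun j => col j = col u) := by
          rw [disjoint_filter]
          intro i _ h h'
          exact h1 (h' ▸ h)
        rw [← card_union_of_disjoint hd]
        apply card_lt_card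
        refine ⟨union_subset (filter_subset _ _) (filter_subset _ _), fun hs => ?_⟩
        have := hs hvV
        simp only [mem_union, mem_filter] at this
        tauto
      have htot := card_filter_add_card_filter_not (s := V) (fun j => col j = c)
      simp only [ne_eq] at *
      omega)
    have hdis : Disjoint ({u, v} : Finset ι) (pairSupp P) :=
      disjoint_of_subset_right hPV disjoint_sdiff
    rw [disjoint_insert_left, disjoint_singleton_left] at hdis
    refine ⟨insert (u, v) P, hP.insert hne hdis.1 hdis.2, ?_, ?_, ?_⟩
    · rw [card_insert_of_notMem, hPt]
      intro h
      exact hdis.1 (mem_pairSupp.2 ⟨_, h, Or.inl rfl⟩)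
    · rw [pairSupp_insert]
      exact union_subset hsub (hPV.trans sdiff_subset)
    · intro e he
      rcases mem_insert.1 he with rfl | he
      · exact fun h => huv h.symm
      · exact hPc e he

theorem exists_transversal_sum {ι : Type*} {p : ℕ} [Fact p.Prime] (a : ι → ZMod p)
    (P : Finset (ι × ι)) (hP : DisjPairs P) (hPa : ∀ e ∈ P, a e.1 ≠ a e.2) (hc : p ≤ #P + 1)
    (x : ZMod p) : ∃ D ⊆ pairSupp P, #D = #P ∧ ∑ i ∈ D, a i = x := by
  have key : ∀ Q : Finset (ι × ι), Q ⊆ P → ∃ X : Finset (ZMod p), min p (#Q + 1) ≤ #X ∧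
      ∀ x ∈ X, ∃ D ⊆ pairSupp Q, #D = #Q ∧ ∑ i ∈ D, a i = x := by
    intro Q
    induction Q using Finset.induction_on with
    | empty => exact fun _ => ⟨{0}, by simp, by simp⟩
    | insert e Q he ih =>
      intro hQ
      obtain ⟨X, hX, hXD⟩ := ih ((subset_insert _ _).trans hQ)
      obtain ⟨h1, h2, h3⟩ := (hP.subset hQ).of_insert he
      rw [disjoint_insert_left, disjoint_singleton_left] at h3
      have hae := hPa e (hQ (mem_insert_self _ _))
      have hXne : X.Nonempty := card_pos.1 (lt_of_lt_of_le (by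
        have := (Fact.out : p.Prime).pos
        simp [this]) hX)
      refine ⟨{a e.1, a e.2} + X, ?_, ?_⟩
      · have := ZMod.cauchy_davenport Fact.out (s := {a e.1, a e.2}) (t := X) ⟨a e.1, by simp⟩ hXne
        rw [card_pair hae] at this
        rw [card_insert_of_notMem he]
        omega
      · have hh : ∀ i, i ∉ pairSupp Q → (i = e.1 ∨ i = e.2) → ∀ x ∈ X,
            ∃ D ⊆ pairSupp (insert e Q), #D = #(insert e Q) ∧ ∑ j ∈ D, a j = a i + x := by
          intro i hi hie x hx
          obtain ⟨D, hD, hDc, hDs⟩ := hXD x hx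
          have hiD : i ∉ D := fun h => hi (hD h)
          refine ⟨insert i D, ?_, ?_, ?_⟩
          · intro j hj
            rw [mem_pairSupp]
            rcases mem_insert.1 hj with rfl | hj
            · exact ⟨e, mem_insert_self _ _, hie⟩
            · obtain ⟨e', he', h⟩ := mem_pairSupp.1 (hD hj)
              exact ⟨e', mem_insert_of_mem he', h⟩
          · rw [card_insert_of_notMem hiD, card_insert_of_notMem he, hDc]
          · rw [sum_insert hiD, hDs]
        intro y hy
        obtain ⟨b, hb, x, hx, rfl⟩ := mem_add.1 hy
        simp only [mem_insert, mem_singleton] at hb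
        rcases hb with rfl | rfl
        · exact hh _ h3.1 (Or.inl rfl) x hx
        · exact hh _ h3.2 (Or.inr rfl) x hx
  obtain ⟨X, hX, hXD⟩ := key P subset_rfl
  have : X = univ := by
    rw [← card_eq_iff_eq_univ, ZMod.card]
    refine le_antisymm ?_ (by simpa [hc] using hX)
    simpa using card_le_univ X
  exact hXD x (this ▸ mem_univ x)

theorem exists_prod_eq_one_card {ι A : Type*} [CommGroup A] [Finite A] [IsCyclic A] (t : ι → A)
    (I : Finset ι) (hI : 2 * Nat.card A ≤ #I + 1) :
    ∃ B ⊆ I, #B = Nat.card A ∧ ∏ i ∈ B, t i = 1 := by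
  let φ := zmodCyclicMulEquiv (G := A) inferInstance
  obtain ⟨B, hB, hBc, hBs⟩ := ZMod.erdos_ginzburg_ziv (n := Nat.card A) (s := I)
    (fun i => (φ.symm (t i)).toAdd) (by omega)
  refine ⟨B, hB, hBc, φ.symm.injective ?_⟩
  rw [map_prod, map_one]
  apply Multiplicative.toAdd.injective
  rw [toAdd_prod, hBs, toAdd_one]

theorem exists_prod_eq_one_card_mul {ι A : Type*} [CommGroup A] [Finite A] [IsCyclic A]
    (t : ι → A) (j : ℕ) :
    ∀ I : Finset ι, (j + 1) * Nat.card A ≤ #I + 1 →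
    ∃ B ⊆ I, #B = j * Nat.card A ∧ ∏ i ∈ B, t i = 1 := by
  induction j with
  | zero => exact fun I _ => ⟨∅, by simp, by simp, by simp⟩
  | succ j ih =>
    intro I hI
    have e : (j + 1 + 1) * Nat.card A = j * Nat.card A + 2 * Nat.card A := by ring
    obtain ⟨B, hB, hBc, hB1⟩ := exists_prod_eq_one_card t I (by omega)
    have := card_sdiff_add_card_eq_card hB
    obtain ⟨B', hB', hB'c, hB'1⟩ := ih (I \ B) (by
      have : (j + 1) * Nat.card A = j * Nat.card A + Nat.card A := by ring
      omega)
    have hd : Disjoint B B' := disjoint_of_subset_right hB' disjoint_sdiff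
    refine ⟨B ∪ B', union_subset hB (hB'.trans sdiff_subset), ?_, ?_⟩
    · rw [card_union_of_disjoint hd, hBc, hB'c]; ring
    · rw [prod_union hd, hB1, hB'1, one_mul]

/-- Among `p` elements of `ZMod p` there is a nonempty zero-sum family. -/
theorem exists_sum_eq_zero {ι : Type*} {p : ℕ} [Fact p.Prime] (a : ι → ZMod p) (I : Finset ι)
    (hI : p ≤ #I) : ∃ B ⊆ I, B.Nonempty ∧ ∑ i ∈ B, a i = 0 := by
  obtain ⟨B, hB, hBc, hBs⟩ := ZMod.erdos_ginzburg_ziv (n := p)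
    (s := I.disjSum (range (p - 1))) (Sum.elim a fun _ => 0) (by
      rw [card_disjSum, card_range]
      have := (Fact.out : p.Prime).pos
      omega)
  refine ⟨B.toLeft, ?_, ?_, ?_⟩
  · intro i hi
    simpa using hB (mem_toLeft.1 hi)
  · rw [← card_pos]
    have h1 := card_toLeft_add_card_toRight (u := B)
    have h2 : #B.toRight ≤ p - 1 := by
      rw [← card_range (p - 1)]
      apply card_le_card
      intro i hi
      simpa using hB (mem_toRight.1 hi)
    have := (Fact.out : p.Prime).pos
    omega
  · rw [← hBs, ← toLeft_disjSum_toRight (u := B), sum_disjSum]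
    simp

end

/-- The version of `exists_subgroup_cover` relative to a proper subgroup `M`. -/
theorem exists_subgroup_cover_rel {ι A : Type*} [CommGroup A] [Finite A] (M : Subgroup A)
    (hM : M ≠ ⊤) (c : ι → A) (I : Finset ι) (hc : ∀ j ∈ I, c j ∉ M)
    (hI : Nat.card (A ⧸ M) ≤ #I + 1) :
    ∃ K : Subgroup A, M < K ∧ ∃ J ⊆ I, (#J + 1) * Nat.card M = Nat.card K ∧ (∀ j ∈ J, c j ∈ K) ∧
      ∀ c' : ι → A, (∀ j ∈ J, ∀ L : Subgroup A, c' j ∈ L ↔ c j ∈ L) →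
        ∀ k ∈ K, ∃ T ⊆ J, ∃ z ∈ M, (∏ i ∈ T, c' i) * z = k := by
  have hidx : M.index ≠ 1 := fun h => hM (Subgroup.index_eq_one.1 h)
  have hidx0 : M.index ≠ 0 := Subgroup.index_ne_zero_of_finite
  obtain ⟨K, hK, J, hJI, hJc, hJK, hcov⟩ := exists_subgroup_cover
    (fun i => (QuotientGroup.mk' M) (c i)) I
    (fun j hj h => hc j hj ((QuotientGroup.eq_one_iff _).1 h))
    (by change 2 ≤ M.index; omega) hI
  refine ⟨K.comap (QuotientGroup.mk' M), ?_, J, hJI, ?_, fun j hj => hJK j hj, ?_⟩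
  · refine lt_of_le_of_ne (QuotientGroup.le_comap_mk' M K) fun h => hK ?_
    rw [eq_bot_iff]
    intro a ha
    obtain ⟨a, rfl⟩ := QuotientGroup.mk'_surjective M a
    have : a ∈ M := by rw [h]; exact ha
    exact (QuotientGroup.eq_one_iff _).2 this
  · rw [hJc]
    have h1 := K.index_comap_of_surjective (QuotientGroup.mk'_surjective M)
    have h2 := (K.comap (QuotientGroup.mk' M)).index_mul_card
    have h3 := K.index_mul_card
    have h4 := M.index_mul_card
    have h5 : M.index = Nat.card (A ⧸ M) := rfl
    have h6 : 0 < K.index := Nat.pos_of_ne_zero Subgroup.index_ne_zero_of_finite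
    apply Nat.eq_of_mul_eq_mul_left h6
    rw [← mul_assoc, h3, ← h5, h4, ← h2, h1]
  · intro c' hc' k hk
    obtain ⟨T, hT, h⟩ := hcov (fun i => QuotientGroup.mk' M (c' i))
      (fun j hj L => hc' j hj (L.comap (QuotientGroup.mk' M))) (QuotientGroup.mk' M k) hk
    refine ⟨T, hT, (∏ i ∈ T, c' i)⁻¹ * k, ?_, by simp⟩
    rw [← QuotientGroup.eq_one_iff]
    have hone : QuotientGroup.mk' M ((∏ i ∈ T, c' i)⁻¹ * k) = 1 := by
      rw [map_mul, map_inv, map_prod, h, inv_mul_cancel]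
    exact hone

/-- The set of products of the family `s` over `I`, over all orderings. -/
def famProds {ι G : Type*} [Group G] (s : ι → G) (I : Finset ι) : Set G :=
  {g | ∃ l : List ι, (l : Multiset ι) = I.val ∧ (l.map s).prod = g}

section
open scoped Classical
variable {ι G : Type*} [Group G] {s : ι → G} {I J : Finset ι}

theorem one_mem_famProds_empty (s : ι → G) : (1 : G) ∈ famProds s ∅ := ⟨[], rfl, rfl⟩

theorem famProds_singleton (s : ι → G) (i : ι) : s i ∈ famProds s {i} := ⟨[i], rfl, by simp⟩

theorem famProds_nonempty (s : ι → G) (I : Finset ι) : ∃ g, g ∈ famProds s I :=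
  ⟨_, I.toList, by simp, rfl⟩

theorem mul_mem_famProds {a b : G} (hd : Disjoint I J) (ha : a ∈ famProds s I)
    (hb : b ∈ famProds s J) : a * b ∈ famProds s (I ∪ J) := by
  obtain ⟨l, hl, rfl⟩ := ha
  obtain ⟨l', hl', rfl⟩ := hb
  refine ⟨l ++ l', ?_, by simp⟩
  rw [← disjUnion_eq_union _ _ hd, ← Multiset.coe_add, hl, hl']
  rfl

theorem cons_mem_famProds {i : ι} (hi : i ∉ I) {a : G} (ha : a ∈ famProds s I) :
    s i * a ∈ famProds s (insert i I) := by
  rw [insert_eq]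
  exact mul_mem_famProds (by simpa using hi) (famProds_singleton s i) ha

/-- Rotating a product so that it starts with a given index. -/
theorem famProds_rotate {g : G} (hg : g ∈ famProds s I) {i : ι} (hi : i ∈ I) :
    ∃ a b : G, g = a * s i * b ∧ b * a ∈ famProds s (I.erase i) := by
  obtain ⟨l, hl, rfl⟩ := hg
  have hil : i ∈ l := by
    have : i ∈ (l : Multiset ι) := by rw [hl]; exact hi
    simpa using this
  obtain ⟨l₁, l₂, rfl⟩ := List.append_of_mem hil
  refine ⟨(l₁.map s).prod, (l₂.map s).prod, by simp [mul_assoc], l₂ ++ l₁, ?_, by simp⟩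
  rw [erase_val, ← hl, Multiset.coe_erase, Multiset.coe_eq_coe]
  have h1 : (l₁ ++ i :: l₂).Perm (i :: (l₂ ++ l₁)) :=
    List.perm_middle.trans ((List.perm_append_comm).cons i)
  have := h1.erase i
  rw [List.erase_cons_head] at this
  exact this.symm

theorem map_mem_famProds {H : Type*} [Group H] (f : G →* H) {g : G} (hg : g ∈ famProds s I) :
    f g ∈ famProds (fun i => f (s i)) I := by
  obtain ⟨l, hl, rfl⟩ := hg
  exact ⟨l, hl, by rw [map_list_prod, List.map_map]; rfl⟩

theorem exists_of_mem_famProds_map {H : Type*} [Group H] (f : G →* H) {h : H}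
    (hh : h ∈ famProds (fun i => f (s i)) I) : ∃ g ∈ famProds s I, f g = h := by
  obtain ⟨l, hl, rfl⟩ := hh
  exact ⟨_, ⟨l, hl, rfl⟩, by rw [map_list_prod, List.map_map]; rfl⟩

theorem famProds_congr {s' : ι → G} (h : ∀ i ∈ I, s i = s' i) : famProds s I = famProds s' I := by
  have key : ∀ s s' : ι → G, (∀ i ∈ I, s i = s' i) → famProds s I ⊆ famProds s' I := by
    rintro s s' h _ ⟨l, hl, rfl⟩
    refine ⟨l, hl, ?_⟩
    congr 1
    apply List.map_congr_left
    intro i hi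
    refine (h i ?_).symm
    have : i ∈ (l : Multiset ι) := by simpa using hi
    rw [hl] at this
    exact this
  exact Set.Subset.antisymm (key _ _ h) (key _ _ fun i hi => (h i hi).symm)

theorem mem_famProds_comm {A : Type*} [CommGroup A] (t : ι → A) {a : A} :
    a ∈ famProds t I ↔ ∏ i ∈ I, t i = a := by
  constructor
  · rintro ⟨l, hl, rfl⟩
    rw [Finset.prod, ← hl]
    simp
  · rintro rfl
    exact ⟨I.toList, by simp, by simp⟩

theorem map_eq_prod_of_mem_famProds {A : Type*} [CommGroup A] (f : G →* A) {g : G}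
    (hg : g ∈ famProds s I) : f g = ∏ i ∈ I, f (s i) :=
  ((mem_famProds_comm _).1 (map_mem_famProds f hg)).symm

theorem map_prod_mem_famProds {A : Type*} [CommGroup A] (ν : A →* G) (t : ι → A)
    (h : ∀ i ∈ I, ν (t i) = s i) : ν (∏ i ∈ I, t i) ∈ famProds s I := by
  rw [famProds_congr fun i hi => (h i hi).symm]
  exact map_mem_famProds ν ((mem_famProds_comm t).2 rfl)


end

/-- `G` is an extension of `ZMod p` by the cyclic group `A`, the elements outside `A` act on `A`
without nontrivial fixed points and all prime divisors of `|A|` exceed the prime `p`. -/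
structure FrobeniusExt (p : ℕ) {G A : Type*} [Group G] [CommGroup A]
    (χ : G →* Multiplicative (ZMod p)) (ν : A →* G) : Prop where
  prime : p.Prime
  nontriv : ∃ g, χ g ≠ 1
  cyc : IsCyclic A
  inj : Function.Injective ν
  ker : ∀ g, χ g = 1 ↔ ∃ a, ν a = g
  fpf : ∀ g a, χ g ≠ 1 → g * ν a = ν a * g → a = 1
  lt : ∀ q, q ∣ Nat.card A → q ≠ 1 → p < q

namespace FrobeniusExt

section
open scoped Classical
variable {p : ℕ} {G A : Type*} [Group G] [CommGroup A]
  {χ : G →* Multiplicative (ZMod p)} {ν : A →* G}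

theorem map_eq_one (h : FrobeniusExt p χ ν) (a : A) : χ (ν a) = 1 := (h.ker _).2 ⟨a, rfl⟩

/-- A left inverse of `ν`, with junk value `1` outside the range. -/
noncomputable def pre (_ : FrobeniusExt p χ ν) (g : G) : A :=
  if h : ∃ a, ν a = g then h.choose else 1

theorem map_pre (h : FrobeniusExt p χ ν) {g : G} (hg : χ g = 1) : ν (h.pre g) = g := by
  have := (h.ker g).1 hg
  rw [pre, dif_pos this]
  exact this.choose_spec

theorem chi_conj (h : FrobeniusExt p χ ν) (g : G) (a : A) : χ (g * ν a * g⁻¹) = 1 := by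
  simp [h.map_eq_one]

/-- The conjugation action of `G` on `A`. -/
noncomputable def conj (h : FrobeniusExt p χ ν) (g : G) : A →* A where
  toFun a := h.pre (g * ν a * g⁻¹)
  map_one' := h.inj (by rw [h.map_pre (h.chi_conj g 1)]; simp)
  map_mul' a b := h.inj (by
    rw [map_mul ν (h.pre _), h.map_pre (h.chi_conj g _), h.map_pre (h.chi_conj g _),
      h.map_pre (h.chi_conj g _)]
    simp [mul_assoc])

theorem map_conj (h : FrobeniusExt p χ ν) (g : G) (a : A) : ν (h.conj g a) = g * ν a * g⁻¹ :=
  h.map_pre (h.chi_conj g a)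

theorem mul_map (h : FrobeniusExt p χ ν) (g : G) (a : A) : g * ν a = ν (h.conj g a) * g := by
  rw [h.map_conj]; group

theorem conj_mul (h : FrobeniusExt p χ ν) (g g' : G) (a : A) :
    h.conj (g * g') a = h.conj g (h.conj g' a) :=
  h.inj (by simp [h.map_conj, mul_assoc])

theorem conj_one (h : FrobeniusExt p χ ν) (a : A) : h.conj 1 a = a :=
  h.inj (by simp [h.map_conj])

theorem conj_mem (h : FrobeniusExt p χ ν) {M : Subgroup A} {a : A} (ha : a ∈ M) (g : G) :
    h.conj g a ∈ M := by
  have := h.cyc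
  obtain ⟨k, hk⟩ := MonoidHom.map_cyclic (h.conj g)
  rw [hk]
  exact M.zpow_mem ha k

theorem conj_mem_iff (h : FrobeniusExt p χ ν) {M : Subgroup A} {a : A} (g : G) :
    h.conj g a ∈ M ↔ a ∈ M := by
  refine ⟨fun ha => ?_, fun ha => h.conj_mem ha g⟩
  have := h.conj_mem ha g⁻¹
  rwa [← h.conj_mul, inv_mul_cancel, h.conj_one] at this

theorem conj_surj (h : FrobeniusExt p χ ν) {M : Subgroup A} (g : G) {a : A} (ha : a ∈ M) :
    ∃ b ∈ M, h.conj g b = a :=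
  ⟨h.conj g⁻¹ a, h.conj_mem ha _, by rw [← h.conj_mul, mul_inv_cancel, h.conj_one]⟩

theorem eq_one_of_conj (h : FrobeniusExt p χ ν) {g : G} (hg : χ g ≠ 1) {a : A}
    (ha : h.conj g a = a) : a = 1 :=
  h.fpf g a hg (by rw [h.mul_map, ha])

/-- The endomorphism `a ↦ g a g⁻¹ a⁻¹` of `A`. -/
noncomputable def commHom (h : FrobeniusExt p χ ν) (g : G) : A →* A where
  toFun a := h.conj g a * a⁻¹
  map_one' := by simp
  map_mul' a b := by
    rw [map_mul, mul_inv, mul_mul_mul_comm]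

theorem commHom_apply (h : FrobeniusExt p χ ν) (g : G) (a : A) :
    h.commHom g a = h.conj g a * a⁻¹ := rfl

theorem commHom_injective (h : FrobeniusExt p χ ν) {g : G} (hg : χ g ≠ 1) :
    Function.Injective (h.commHom g) := by
  rw [injective_iff_map_eq_one]
  intro a ha
  exact h.eq_one_of_conj hg (mul_inv_eq_one.1 ha)

theorem commHom_mem (h : FrobeniusExt p χ ν) {M : Subgroup A} {a : A} (ha : a ∈ M) (g : G) :
    h.commHom g a ∈ M := M.mul_mem (h.conj_mem ha g) (M.inv_mem ha)

theorem commHom_surj [Finite A] (h : FrobeniusExt p χ ν) {M : Subgroup A} {g : G} (hg : χ g ≠ 1)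
    {a : A} (ha : a ∈ M) : ∃ b ∈ M, h.commHom g b = a := by
  have hs := Finite.surjective_of_injective
    (f := fun b : M => (⟨h.commHom g b, h.commHom_mem b.2 g⟩ : M))
    (fun a b hab => Subtype.ext (h.commHom_injective hg (congrArg Subtype.val hab))) ⟨a, ha⟩
  obtain ⟨b, hb⟩ := hs
  exact ⟨b, b.2, congrArg Subtype.val hb⟩

theorem mem_of_commHom_mem [Finite A] (h : FrobeniusExt p χ ν) {M : Subgroup A} {g : G}
    (hg : χ g ≠ 1) {a : A} (ha : h.commHom g a ∈ M) : a ∈ M := by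
  obtain ⟨b, hb, hab⟩ := h.commHom_surj hg ha
  rwa [← h.commHom_injective hg hab]

theorem pow_eq_one (h : FrobeniusExt p χ ν) {g : G} (hg : χ g ≠ 1) : g ^ p = 1 := by
  have : χ (g ^ p) = 1 := by
    rw [map_pow]
    apply Multiplicative.toAdd.injective
    have := Fact.mk h.prime
    simp
  obtain ⟨a, ha⟩ := (h.ker _).1 this
  have := h.fpf g a hg (by rw [ha, ← pow_succ, ← pow_succ'])
  rw [← ha, this, map_one]

theorem map_commute (h : FrobeniusExt p χ ν) {g g' : G} (hg : χ g = 1) (hg' : χ g' = 1) :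
    g * g' = g' * g := by
  rw [← h.map_pre hg, ← h.map_pre hg', ← map_mul, mul_comm, map_mul]

theorem exists_pow_chi (h : FrobeniusExt p χ ν) {g : G} (hg : χ g ≠ 1) (g' : G) :
    ∃ k : ℕ, χ g' = χ (g ^ k) := by
  have := Fact.mk h.prime
  have hz : (χ g).toAdd ≠ 0 := hg
  refine ⟨((χ g').toAdd * (χ g).toAdd⁻¹).val, ?_⟩
  apply Multiplicative.toAdd.injective
  rw [map_pow, toAdd_pow, nsmul_eq_mul, ZMod.natCast_val, ZMod.cast_id, mul_assoc,
    inv_mul_cancel₀ hz, mul_one]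

theorem eq_pow_of_commute (h : FrobeniusExt p χ ν) {g : G} (hg : χ g ≠ 1) {g' : G}
    (hc : g * g' = g' * g) : ∃ k : ℕ, g' = g ^ k := by
  obtain ⟨k, hk⟩ := h.exists_pow_chi hg g'
  refine ⟨k, ?_⟩
  obtain ⟨a, ha⟩ := (h.ker (g' * (g ^ k)⁻¹)).1 (by rw [map_mul, map_inv, hk, mul_inv_cancel])
  have h1 : a = 1 := by
    apply h.fpf g a hg
    rw [ha]
    have : Commute g (g' * (g ^ k)⁻¹) :=
      Commute.mul_right hc ((Commute.refl g).pow_right k).inv_right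
    exact this
  rw [h1, map_one] at ha
  exact (mul_inv_eq_one.1 ha.symm)

theorem commute_trans (h : FrobeniusExt p χ ν) {g₁ g₂ g₃ : G} (h1 : g₁ ≠ 1) (h2 : g₂ ≠ 1)
    (h3 : g₃ ≠ 1) (h12 : Commute g₁ g₂) (h23 : Commute g₂ g₃) : Commute g₁ g₃ := by
  by_cases hg : χ g₂ = 1
  · have key : ∀ g, Commute g₂ g → χ g = 1 := by
      intro g hc
      by_contra hcon
      apply h2
      rw [← h.map_pre hg, h.fpf g (h.pre g₂) hcon (by rw [h.map_pre hg]; exact hc.symm), map_one]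
    exact h.map_commute (key _ h12.symm) (key _ h23)
  · obtain ⟨k, rfl⟩ := h.eq_pow_of_commute hg h12.symm
    obtain ⟨l, rfl⟩ := h.eq_pow_of_commute hg h23
    exact Commute.pow_pow_self _ _ _

theorem normal_map (h : FrobeniusExt p χ ν) (M : Subgroup A) : (M.map ν).Normal := by
  constructor
  rintro _ ⟨a, ha, rfl⟩ g
  exact ⟨h.conj g a, h.conj_mem ha g, h.map_conj g a⟩

theorem mem_map (h : FrobeniusExt p χ ν) (M : Subgroup A) (a : A) : ν a ∈ M.map ν ↔ a ∈ M := by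
  constructor
  · rintro ⟨b, hb, hab⟩
    rwa [← h.inj hab]
  · exact fun ha => ⟨a, ha, rfl⟩

theorem chi_of_mem (h : FrobeniusExt p χ ν) {M : Subgroup A} {g : G} (hg : g ∈ M.map ν) :
    χ g = 1 := by
  obtain ⟨a, _, rfl⟩ := hg
  exact h.map_eq_one a

theorem pre_mem (h : FrobeniusExt p χ ν) {M : Subgroup A} {g : G} (hg : g ∈ M.map ν) :
    h.pre g ∈ M := by
  rwa [← h.mem_map, h.map_pre (h.chi_of_mem hg)]

theorem mem_map_iff_pre (h : FrobeniusExt p χ ν) {M : Subgroup A} {g : G} (hg : χ g = 1) :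
    g ∈ M.map ν ↔ h.pre g ∈ M := by
  rw [← h.mem_map, h.map_pre hg]

theorem map_le_ker (h : FrobeniusExt p χ ν) (M : Subgroup A) : M.map ν ≤ χ.ker :=
  fun _ hg => h.chi_of_mem hg

theorem quot [Finite A] (h : FrobeniusExt p χ ν) (M : Subgroup A) [(M.map ν).Normal] :
    FrobeniusExt p (QuotientGroup.lift (M.map ν) χ (h.map_le_ker M))
      (QuotientGroup.map M (M.map ν) ν (Subgroup.le_comap_map ν M)) where
  prime := h.prime
  nontriv := by
    obtain ⟨g, hg⟩ := h.nontriv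
    exact ⟨QuotientGroup.mk g, by simpa using hg⟩
  cyc := by
    have := h.cyc
    exact isCyclic_of_surjective (QuotientGroup.mk' M) (QuotientGroup.mk'_surjective M)
  inj := by
    rw [injective_iff_map_eq_one]
    intro a
    refine QuotientGroup.induction_on a fun a ha => ?_
    rw [QuotientGroup.map_mk, QuotientGroup.eq_one_iff, h.mem_map] at ha
    exact (QuotientGroup.eq_one_iff a).2 ha
  ker := by
    intro g
    refine QuotientGroup.induction_on g fun g => ?_
    constructor
    · intro hg
      obtain ⟨a, ha⟩ := (h.ker g).1 (by simpa using hg)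
      exact ⟨QuotientGroup.mk a, by rw [QuotientGroup.map_mk, ha]⟩
    · rintro ⟨a, ha⟩
      rw [← ha]
      refine QuotientGroup.induction_on a fun a => ?_
      rw [QuotientGroup.map_mk, QuotientGroup.lift_mk, h.map_eq_one]
  fpf := by
    intro g a
    refine QuotientGroup.induction_on g fun g => QuotientGroup.induction_on a fun a hg hc => ?_
    rw [QuotientGroup.lift_mk] at hg
    rw [QuotientGroup.map_mk, ← QuotientGroup.mk_mul, ← QuotientGroup.mk_mul, h.mul_map,
      eq_comm, QuotientGroup.eq] at hc
    refine (QuotientGroup.eq_one_iff a).2 (h.mem_of_commHom_mem hg ?_)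
    have h2 := (h.normal_map M).conj_mem _ hc g
    rw [← h.conj_mem_iff g⁻¹, ← h.mem_map, h.map_conj, h.commHom_apply, map_mul, map_inv]
    have e : g⁻¹ * (ν (h.conj g a) * (ν a)⁻¹) * g⁻¹⁻¹ = (ν a * g)⁻¹ * (ν (h.conj g a) * g) := by
      have h3 : ν (h.conj g a) * (ν a)⁻¹ = (ν a)⁻¹ * ν (h.conj g a) := by
        rw [← map_inv, ← map_mul, ← map_mul, mul_comm]
      rw [h3]; group
    rwa [e]
  lt := fun q hq => h.lt q (hq.trans (Subgroup.card_quotient_dvd_card M))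

/-- The elements of `G` that commute with `g` modulo `M`. -/
def cent (h : FrobeniusExt p χ ν) (M : Subgroup A) (g : G) : Subgroup G :=
  haveI := h.normal_map M
  (Subgroup.centralizer {(QuotientGroup.mk g : G ⧸ M.map ν)}).comap (QuotientGroup.mk' (M.map ν))

theorem mem_cent (h : FrobeniusExt p χ ν) {M : Subgroup A} {g g' : G} [(M.map ν).Normal] :
    g' ∈ h.cent M g ↔ Commute (g : G ⧸ M.map ν) (g' : G ⧸ M.map ν) := by
  unfold cent
  rw [Subgroup.mem_comap, Subgroup.mem_centralizer_singleton_iff]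
  exact eq_comm

theorem self_mem_cent (h : FrobeniusExt p χ ν) {M : Subgroup A} (g : G) : g ∈ h.cent M g := by
  have := h.normal_map M
  exact h.mem_cent.2 rfl

theorem map_le_cent (h : FrobeniusExt p χ ν) {M : Subgroup A} (g : G) {g' : G}
    (hg : g' ∈ M.map ν) : g' ∈ h.cent M g := by
  have := h.normal_map M
  rw [h.mem_cent, (QuotientGroup.eq_one_iff g').2 hg]
  exact Commute.one_right _

theorem cent_eq_of_mem [Finite A] (h : FrobeniusExt p χ ν) {M : Subgroup A} {g g' : G}
    (hg : g ∉ M.map ν) (hg' : g' ∉ M.map ν) (hc : g' ∈ h.cent M g) :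
    h.cent M g = h.cent M g' := by
  have := h.normal_map M
  rw [← QuotientGroup.eq_one_iff] at hg hg'
  rw [h.mem_cent] at hc
  ext k
  rw [h.mem_cent, h.mem_cent]
  by_cases hk : (k : G ⧸ M.map ν) = 1
  · simp [hk]
  · exact ⟨fun hh => (h.quot M).commute_trans hg' hg hk hc.symm hh,
      fun hh => (h.quot M).commute_trans hg hg' hk hc hh⟩

theorem mem_of_mem_cent [Finite A] (h : FrobeniusExt p χ ν) {M : Subgroup A} {g g' : G}
    (hg : χ g ≠ 1) (hg' : χ g' = 1) (hc : g' ∈ h.cent M g) : g' ∈ M.map ν := by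
  have := h.normal_map M
  rw [h.mem_cent] at hc
  rw [← h.map_pre hg', h.mem_map, ← QuotientGroup.eq_one_iff]
  refine (h.quot M).fpf (g : G ⧸ M.map ν) _ (by simpa using hg) ?_
  rw [QuotientGroup.map_mk, h.map_pre hg']
  exact hc

theorem cent_of_chi [Finite A] (h : FrobeniusExt p χ ν) {M : Subgroup A} {g g' : G}
    (hg : χ g = 1) (hgM : g ∉ M.map ν) (hc : g' ∈ h.cent M g) : χ g' = 1 := by
  have := h.normal_map M
  by_contra hcon
  exact hgM (h.mem_of_mem_cent hcon hg (h.mem_cent.2 (h.mem_cent.1 hc).symm))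

theorem sub [Finite A] (h : FrobeniusExt p χ ν) (M : Subgroup A) {f : G} (hf : χ f ≠ 1) :
    FrobeniusExt p (χ.comp (h.cent M f).subtype)
      ((ν.comp M.subtype).codRestrict (h.cent M f) fun a =>
        h.map_le_cent f ((h.mem_map M a).2 a.2)) where
  prime := h.prime
  nontriv := ⟨⟨f, h.self_mem_cent f⟩, hf⟩
  cyc := by
    have := h.cyc
    infer_instance
  inj := fun a b hab => Subtype.ext (h.inj (congrArg Subtype.val hab))
  ker := by
    intro g
    constructor
    · intro hg
      obtain ⟨a, ha, hag⟩ := h.mem_of_mem_cent hf hg g.2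
      exact ⟨⟨a, ha⟩, Subtype.ext hag⟩
    · rintro ⟨a, rfl⟩
      exact h.map_eq_one a
  fpf := by
    intro g a hg hc
    exact Subtype.ext (h.fpf g a hg (congrArg Subtype.val hc))
  lt := fun q hq => h.lt q (hq.trans (Subgroup.card_subgroup_dvd_card M))

end
end FrobeniusExt

namespace FrobeniusExt

section
open scoped Classical
variable {p : ℕ} {ι G A : Type*} [Group G] [CommGroup A]
  {χ : G →* Multiplicative (ZMod p)} {ν : A →* G}

/-- The cyclic rotations of an ordering of a minimal block with product in `A` give different
products. -/
theorem exists_finset_famProds (h : FrobeniusExt p χ ν) (s : ι → G) (B : Finset ι)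
    (hB : ∏ i ∈ B, χ (s i) = 1)
    (hmin : ∀ D ⊆ B, D.Nonempty → ∏ i ∈ D, χ (s i) = 1 → D = B) (h1 : 1 ∉ famProds s B) :
    ∃ X : Finset A, #X = #B ∧ ∀ a ∈ X, ν a ∈ famProds s B := by
  set l := B.toList with hl
  have hlB : (l : Multiset ι) = B.val := by simp [hl]
  have hnd : l.Nodup := B.nodup_toList
  have hlen : l.length = #B := B.length_toList
  let P : ℕ → G := fun j => ((l.take j).map s).prod
  let Q : ℕ → G := fun j => ((l.drop j).map s).prod
  have hPQ : ∀ j, P j * Q j = (l.map s).prod := by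
    intro j
    simp only [P, Q]
    rw [← List.prod_append, ← List.map_append, List.take_append_drop]
  have hmem : ∀ j, Q j * P j ∈ famProds s B := by
    intro j
    refine ⟨l.drop j ++ l.take j, ?_, by simp [P, Q]⟩
    rw [← hlB, Multiset.coe_eq_coe]
    exact List.perm_append_comm.trans (by rw [List.take_append_drop])
  have hchi : ∀ j, χ (Q j * P j) = 1 := by
    intro j
    rw [map_eq_prod_of_mem_famProds χ (hmem j), hB]
  have hlt : ∀ j k, j < k → k < #B → Q j * P j ≠ Q k * P k := by
    intro j k hjk hk heq
    set D := ((l.drop j).take (k - j)) with hD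
    have hDsub : D.Sublist l := (List.take_sublist _ _).trans (List.drop_sublist _ _)
    have hDlen : D.length = k - j := by
      rw [hD, List.length_take, List.length_drop]; omega
    have hP : P k = P j * (D.map s).prod := by
      simp only [P]
      rw [← List.prod_append, ← List.map_append, hD, ← List.take_add]
      congr 4; omega
    have hQ : Q j = (D.map s).prod * Q k := by
      simp only [Q]
      rw [← List.prod_append, ← List.map_append, hD]
      have : l.drop k = (l.drop j).drop (k - j) := by
        rw [List.drop_drop]; congr 1; omega
      rw [this, List.take_append_drop]
    have hcomm : (D.map s).prod * (Q k * P k) = (Q k * P k) * (D.map s).prod := by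
      have e1 : (Q k * P k) * (D.map s).prod = Q j * P j * (D.map s).prod := by rw [heq]
      rw [e1, hQ, hP]
      simp only [mul_assoc]
    have hDprod : χ (D.map s).prod = 1 := by
      by_contra hcon
      have := h.fpf _ (h.pre (Q k * P k)) hcon (by rw [h.map_pre (hchi k)]; exact hcomm)
      apply h1
      have h2 := h.map_pre (hchi k)
      rw [this, map_one] at h2
      rw [h2]
      exact hmem k
    have hDf : D.toFinset.val = D := by
      rw [List.toFinset_val, (hDsub.nodup hnd).dedup]
    have hprod : ∏ i ∈ D.toFinset, χ (s i) = 1 := by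
      rw [← hDprod]
      exact (map_eq_prod_of_mem_famProds χ ⟨D, hDf.symm, rfl⟩).symm
    have hcardD : #D.toFinset = k - j := by
      rw [← hDlen, List.toFinset_card_of_nodup (hDsub.nodup hnd)]
    have := hmin D.toFinset (fun i hi => by
      have := hDsub.subset (List.mem_toFinset.1 hi)
      simpa [hl] using this) (card_pos.1 (by omega)) hprod
    rw [this] at hcardD
    omega
  have hinj : ∀ j < #B, ∀ k < #B, h.pre (Q j * P j) = h.pre (Q k * P k) → j = k := by
    intro j hj k hk heq
    have heq' := congrArg ν heq
    rw [h.map_pre (hchi j), h.map_pre (hchi k)] at heq'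
    rcases lt_trichotomy j k with hjk | hjk | hjk
    · exact absurd heq' (hlt j k hjk hk)
    · exact hjk
    · exact absurd heq'.symm (hlt k j hjk hj)
  refine ⟨(range #B).image fun j => h.pre (Q j * P j), ?_, ?_⟩
  · rw [card_image_of_injOn, card_range]
    intro j hj k hk
    exact hinj j (by simpa using hj) k (by simpa using hk)
  · intro a ha
    obtain ⟨j, _, rfl⟩ := mem_image.1 ha
    rw [h.map_pre (hchi j)]
    exact hmem j

theorem card_le_of_product_one_free [Finite A] (h : FrobeniusExt p χ ν) (s : ι → G)
    (J : Finset ι) : (∀ I ⊆ J, I.Nonempty → 1 ∉ famProds s I) →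
      ∃ Z : Finset A, (∀ a, a ∈ Z ↔ ∃ I ⊆ J, ν a ∈ famProds s I) ∧ #J + 2 ≤ #Z + p := by
  have := Fintype.ofFinite A
  induction J using Finset.strongInduction with
  | H J ih =>
  intro hJ
  refine ⟨univ.filter fun a => ∃ I ⊆ J, ν a ∈ famProds s I, by simp, ?_⟩
  set Z := univ.filter fun a => ∃ I ⊆ J, ν a ∈ famProds s I with hZ
  have hmemZ : ∀ a, a ∈ Z ↔ ∃ I ⊆ J, ν a ∈ famProds s I := by simp [hZ]
  by_cases hJp : #J < p
  · have : 0 < #Z := card_pos.2 ⟨1, (hmemZ 1).2 ⟨∅, by simp, by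
      rw [map_one]; exact one_mem_famProds_empty s⟩⟩
    omega
  have := Fact.mk h.prime
  obtain ⟨B₀, hB₀J, hB₀ne, hB₀s⟩ := exists_sum_eq_zero (fun i => (χ (s i)).toAdd) J (by omega)
  have hset : ∃ B ∈ J.powerset.filter (fun B => B.Nonempty ∧ ∏ i ∈ B, χ (s i) = 1),
      ∀ D ∈ J.powerset.filter (fun B => B.Nonempty ∧ ∏ i ∈ B, χ (s i) = 1), #B ≤ #D := by
    apply exists_min_image
    refine ⟨B₀, ?_⟩
    rw [mem_filter, mem_powerset]
    refine ⟨hB₀J, hB₀ne, ?_⟩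
    apply Multiplicative.toAdd.injective
    rw [toAdd_prod, hB₀s, toAdd_one]
  obtain ⟨B, hB, hmin⟩ := hset
  rw [mem_filter, mem_powerset] at hB
  obtain ⟨hBJ, hBne, hB1⟩ := hB
  obtain ⟨X, hXc, hX⟩ := h.exists_finset_famProds s B hB1 (by
    intro D hD hDne hD1
    refine eq_of_subset_of_card_le hD (hmin D ?_)
    rw [mem_filter, mem_powerset]
    exact ⟨hD.trans hBJ, hDne, hD1⟩) (hJ B hBJ hBne)
  obtain ⟨Z', hZ', hZ'c⟩ := ih (J \ B) (sdiff_ssubset hBJ hBne)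
    (fun I hI => hJ I (hI.trans sdiff_subset))
  have h1X : (1 : A) ∉ X := by
    intro h1
    apply hJ B hBJ hBne
    rw [← map_one ν]
    exact hX 1 h1
  have hmul : ∀ a ∈ Z', ∀ b ∈ X, ∃ I ⊆ J, I.Nonempty ∧ ν (a * b) ∈ famProds s I := by
    intro a ha b hb
    obtain ⟨I, hI, ha⟩ := (hZ' a).1 ha
    refine ⟨I ∪ B, union_subset (hI.trans sdiff_subset) hBJ, hBne.inr, ?_⟩
    rw [map_mul]
    exact mul_mem_famProds (disjoint_of_subset_left hI sdiff_disjoint) ha (hX b hb)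
  have key := card_mul_of_unique_one (insert 1 X) Z'
    ((hZ' 1).2 ⟨∅, by simp, by rw [map_one]; exact one_mem_famProds_empty s⟩)
    (mem_insert_self _ _) (by
      intro a ha b hb hab
      rcases mem_insert.1 hb with rfl | hb
      · simpa using hab
      · obtain ⟨I, hI, hIne, hm⟩ := hmul a ha b hb
        rw [hab, map_one] at hm
        exact absurd hm (hJ I hI hIne))
  have hsub : Z' * insert 1 X ⊆ Z := by
    intro z hz
    obtain ⟨a, ha, b, hb, rfl⟩ := mem_mul.1 hz
    rw [hmemZ]
    rcases mem_insert.1 hb with rfl | hb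
    · obtain ⟨I, hI, ha⟩ := (hZ' a).1 ha
      exact ⟨I, hI.trans sdiff_subset, by simpa using ha⟩
    · obtain ⟨I, hI, _, hm⟩ := hmul a ha b hb
      exact ⟨I, hI, hm⟩
  have h3 := card_le_card hsub
  rw [card_insert_of_notMem h1X] at key
  have h4 := card_sdiff_add_card_eq_card hBJ
  omega

/-- The upper bound for the small Davenport constant. -/
theorem exists_nonempty_product_one [Finite A] (h : FrobeniusExt p χ ν) (s : ι → G) (J : Finset ι)
    (hJ : Nat.card A + p ≤ #J + 1) : ∃ I ⊆ J, I.Nonempty ∧ 1 ∈ famProds s I := by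
  by_contra hcon
  push Not at hcon
  obtain ⟨Z, _, hZ⟩ := h.card_le_of_product_one_free s J hcon
  have := Fintype.ofFinite A
  have := card_le_univ Z
  rw [← Nat.card_eq_fintype_card] at this
  omega

theorem exists_nonempty_famProds_mem [Finite A] (h : FrobeniusExt p χ ν) (M : Subgroup A)
    (s : ι → G) (J : Finset ι) (hJ : Nat.card (A ⧸ M) + p ≤ #J + 1) :
    ∃ I ⊆ J, I.Nonempty ∧ ∃ g ∈ famProds s I, g ∈ M.map ν := by
  have := h.normal_map M
  obtain ⟨I, hI, hIne, h1⟩ :=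
    (h.quot M).exists_nonempty_product_one (fun i => QuotientGroup.mk' (M.map ν) (s i)) J hJ
  obtain ⟨g, hg, hg1⟩ := exists_of_mem_famProds_map _ h1
  exact ⟨I, hI, hIne, g, hg, (QuotientGroup.eq_one_iff g).1 hg1⟩

end
end FrobeniusExt

section
open scoped Classical

theorem exists_prod_eq_one_of_mem {ι A : Type*} [CommGroup A] [Finite A] [IsCyclic A]
    (M : Subgroup A) (t : ι → A) (j : ℕ) (I : Finset ι) (ht : ∀ i ∈ I, t i ∈ M)
    (hI : (j + 1) * Nat.card M ≤ #I + 1) :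
    ∃ B ⊆ I, #B = j * Nat.card M ∧ ∏ i ∈ B, t i = 1 := by
  let t' : ι → M := fun i => if h : t i ∈ M then ⟨t i, h⟩ else 1
  obtain ⟨B, hB, hBc, hB1⟩ := exists_prod_eq_one_card_mul t' j I hI
  refine ⟨B, hB, hBc, ?_⟩
  have := congrArg M.subtype hB1
  rw [map_prod, map_one] at this
  rw [← this]
  refine prod_congr rfl fun i hi => ?_
  simp [t', ht i (hB hi)]

theorem exists_disjoint_blocks {ι A : Type*} [CommGroup A] [Finite A] [IsCyclic A]
    (M : Subgroup A) (t : ι → A) (n k : ℕ) : ∀ I : Finset ι, (∀ i ∈ I, t i ∈ M) →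
    k * (n * Nat.card M) + Nat.card M ≤ #I + 1 →
    ∃ B : ℕ → Finset ι, (∀ j < k, B j ⊆ I ∧ #(B j) = n * Nat.card M ∧ ∏ i ∈ B j, t i = 1) ∧
      ∀ j < k, ∀ j' < k, j ≠ j' → Disjoint (B j) (B j') := by
  induction k with
  | zero => exact fun I _ _ => ⟨fun _ => ∅, by simp, by simp⟩
  | succ k ih =>
    intro I ht hI
    have e : (k + 1) * (n * Nat.card M) = k * (n * Nat.card M) + n * Nat.card M := by ring
    obtain ⟨B₀, hB₀, hB₀c, hB₀1⟩ := exists_prod_eq_one_of_mem M t n I ht (by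
      have : (n + 1) * Nat.card M = n * Nat.card M + Nat.card M := by ring
      omega)
    have := card_sdiff_add_card_eq_card hB₀
    obtain ⟨B, hB, hd⟩ := ih (I \ B₀) (fun i hi => ht i (sdiff_subset hi)) (by omega)
    refine ⟨fun j => if j = k then B₀ else B j, ?_, ?_⟩
    · intro j hj
      by_cases hjk : j = k
      · simp only [hjk, if_true]
        exact ⟨hB₀, hB₀c, hB₀1⟩
      · simp only [hjk, if_false]
        obtain ⟨h1, h2⟩ := hB j (by omega)
        exact ⟨h1.trans sdiff_subset, h2⟩
    · intro j hj j' hj' hne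
      by_cases hjk : j = k
      · have hj'k : j' ≠ k := fun h => hne (hjk.trans h.symm)
        simp only [hjk, hj'k, if_true, if_false]
        exact disjoint_of_subset_right (hB j' (by omega)).1 disjoint_sdiff
      · by_cases hj'k : j' = k
        · simp only [hjk, hj'k, if_true, if_false]
          exact disjoint_of_subset_left (hB j (by omega)).1 sdiff_disjoint
        · simp only [hjk, hj'k, if_false]
          exact hd j (by omega) j' (by omega) hne

end

namespace FrobeniusExt

section
open scoped Classical
variable {p : ℕ} {ι G A : Type*} [Group G] [CommGroup A]
  {χ : G →* Multiplicative (ZMod p)} {ν : A →* G}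

theorem column_mem_famProds (h : FrobeniusExt p χ ν) (s : ι → G) (t : ι → A) (f : G) (x : ℕ → ι)
    (k : ℕ) : (∀ j < k, ∀ j' < k, x j = x j' → j = j') → (∀ j < k, f * ν (t (x j)) = s (x j)) →
    ν (∏ j ∈ range k, h.conj (f ^ (j + 1)) (t (x j))) * f ^ k ∈
      famProds s ((range k).image x) := by
  induction k with
  | zero =>
    intro _ _
    simpa using one_mem_famProds_empty s
  | succ k ih =>
    intro hinj hs
    have h1 := ih (fun j hj j' hj' => hinj j (by omega) j' (by omega)) (fun j hj => hs j (by omega))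
    have h2 := mul_mem_famProds (J := {x k}) (by
      rw [disjoint_singleton_right]
      intro hx
      obtain ⟨j, hj, hjk⟩ := mem_image.1 hx
      rw [mem_range] at hj
      have := hinj j (by omega) k (by omega) hjk
      omega) h1 (famProds_singleton s (x k))
    have e1 : (range (k + 1)).image x = (range k).image x ∪ {x k} := by
      rw [range_add_one, image_insert, insert_eq, union_comm]
    rw [e1, prod_range_succ]
    convert h2 using 1
    rw [← hs k (by omega), map_mul, mul_assoc, mul_assoc, ← mul_assoc (f ^ k) f, ← pow_succ,
      h.mul_map]

theorem columns_mem_famProds (h : FrobeniusExt p χ ν) (s : ι → G) (t : ι → A) {f : G}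
    (hf : χ f ≠ 1) (c : ℕ) : ∀ B : ℕ → Finset ι, (∀ j < p, #(B j) = c) →
    (∀ j < p, ∀ j' < p, j ≠ j' → Disjoint (B j) (B j')) →
    (∀ j < p, ∀ i ∈ B j, f * ν (t i) = s i) →
    ν (∏ j ∈ range p, h.conj (f ^ (j + 1)) (∏ i ∈ B j, t i)) ∈
      famProds s ((range p).biUnion B) := by
  induction c with
  | zero =>
    intro B hB _ _
    have h0 : ∀ j ∈ range p, B j = ∅ := fun j hj => card_eq_zero.1 (hB j (mem_range.1 hj))
    have e1 : (range p).biUnion B = ∅ := by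
      rw [← subset_empty, biUnion_subset]
      exact fun j hj => (h0 j hj).subset
    have e2 : ∏ j ∈ range p, h.conj (f ^ (j + 1)) (∏ i ∈ B j, t i) = 1 := by
      refine prod_eq_one fun j hj => ?_
      rw [h0 j hj, prod_empty, map_one]
    rw [e1, e2, map_one]
    exact one_mem_famProds_empty s
  | succ c ih =>
    intro B hB hd hs
    have hne : ∀ j, ∃ i, j < p → i ∈ B j := by
      intro j
      by_cases hj : j < p
      · obtain ⟨i, hi⟩ := card_pos.1 (by rw [hB j hj]; omega : 0 < #(B j))
        exact ⟨i, fun _ => hi⟩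
      · obtain ⟨i, hi⟩ := card_pos.1 (by rw [hB 0 h.prime.pos]; omega : 0 < #(B 0))
        exact ⟨i, fun h => absurd h hj⟩
    choose x hx using hne
    have h1 := h.column_mem_famProds s t f x p (by
      intro j hj j' hj' hxx
      by_contra hne
      exact (disjoint_left.1 (hd j hj j' hj' hne)) (hx j hj) (hxx ▸ hx j' hj'))
      (fun j hj => hs j hj _ (hx j hj))
    rw [h.pow_eq_one hf, mul_one] at h1
    have h2 := ih (fun j => (B j).erase (x j))
      (fun j hj => by rw [card_erase_of_mem (hx j hj), hB j hj]; rfl)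
      (fun j hj j' hj' hne => disjoint_of_subset_left (erase_subset _ _)
        (disjoint_of_subset_right (erase_subset _ _) (hd j hj j' hj' hne)))
      (fun j hj i hi => hs j hj i (erase_subset _ _ hi))
    have hdis : Disjoint ((range p).image x) ((range p).biUnion fun j => (B j).erase (x j)) := by
      rw [disjoint_left]
      intro i hi hi'
      obtain ⟨j, hj, rfl⟩ := mem_image.1 hi
      obtain ⟨j', hj', hjj⟩ := mem_biUnion.1 hi'
      rw [mem_range] at hj hj'
      by_cases hne : j = j'
      · subst hne
        simp at hjj
      · exact (disjoint_left.1 (hd j hj j' hj' hne)) (hx j hj) (erase_subset _ _ hjj)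
    have h3 := mul_mem_famProds hdis h1 h2
    rw [← map_mul, ← prod_mul_distrib] at h3
    convert h3 using 2
    · ext i
      simp only [mem_biUnion, mem_union, mem_image, mem_range, mem_erase]
      constructor
      · rintro ⟨j, hj, hi⟩
        by_cases hij : i = x j
        · exact Or.inl ⟨j, hj, hij.symm⟩
        · exact Or.inr ⟨j, hj, hij, hi⟩
      · rintro (⟨j, hj, rfl⟩ | ⟨j, hj, _, hi⟩)
        · exact ⟨j, hj, hx j hj⟩
        · exact ⟨j, hj, hi⟩
    · refine prod_congr rfl fun j hj => ?_
      rw [← map_mul, mul_prod_erase _ _ (hx j (mem_range.1 hj))]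

/-- A long family in a single coset of `M` has a product-one subfamily of length `p * |A|`. -/
theorem exists_of_coset [Finite A] (h : FrobeniusExt p χ ν) (M : Subgroup A) (s : ι → G) (f : G)
    (V : Finset ι) (hV : ∀ i ∈ V, f⁻¹ * s i ∈ M.map ν)
    (hc : p * Nat.card A + Nat.card M ≤ #V + 1) :
    ∃ T ⊆ V, #T = p * Nat.card A ∧ 1 ∈ famProds s T := by
  have := h.cyc
  set t : ι → A := fun i => h.pre (f⁻¹ * s i) with ht
  have htM : ∀ i ∈ V, t i ∈ M := fun i hi => h.pre_mem (hV i hi)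
  have hts : ∀ i ∈ V, f * ν (t i) = s i := fun i hi => by
    rw [ht, h.map_pre (h.chi_of_mem (hV i hi))]; group
  have hA : M.index * Nat.card M = Nat.card A := M.index_mul_card
  by_cases hf : χ f = 1
  · obtain ⟨B, hB, hBc, hB1⟩ := exists_prod_eq_one_of_mem M t (p * M.index) V htM (by
      rw [add_mul, mul_assoc, hA]; omega)
    rw [mul_assoc, hA] at hBc
    refine ⟨B, hB, hBc, ?_⟩
    have := map_prod_mem_famProds (s := s) (I := B) ν (fun i => h.pre f * t i) (by
      intro i hi
      rw [map_mul, h.map_pre hf, hts i (hB hi)])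
    rw [prod_mul_distrib, hB1, mul_one, prod_const, hBc, mul_comm, pow_mul, pow_card_eq_one',
      one_pow, map_one] at this
    exact this
  · obtain ⟨B, hB, hd⟩ := exists_disjoint_blocks M t M.index p V htM (by rw [hA]; omega)
    have h1 := h.columns_mem_famProds s t hf (Nat.card A) B
      (fun j hj => by rw [(hB j hj).2.1, hA]) hd (fun j hj i hi => hts i ((hB j hj).1 hi))
    rw [prod_eq_one, map_one] at h1
    · refine ⟨_, ?_, ?_, h1⟩
      · rw [biUnion_subset]
        exact fun j hj => (hB j (mem_range.1 hj)).1
      · rw [card_biUnion fun j hj j' hj' hne => hd j (mem_range.1 hj) j' (mem_range.1 hj') hne,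
          sum_const_nat (m := Nat.card A) fun j hj => by
            rw [(hB j (mem_range.1 hj)).2.1, hA], card_range]
    · intro j hj
      rw [(hB j (mem_range.1 hj)).2.2, map_one]

theorem card_quot_le [Finite A] (M : Subgroup A) : Nat.card (A ⧸ M) ≤ Nat.card A :=
  Nat.le_of_dvd Nat.card_pos (Subgroup.card_quotient_dvd_card M)

/-- If the subset products of a family `W` in `M` exhaust `M` and there are many further elements
of `M`, there is a product-one subfamily of length `p * |A|`. -/
theorem exists_of_subset_products [Finite A] (h : FrobeniusExt p χ ν) (M : Subgroup A) (s : ι → G)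
    (V W : Finset ι) (hWV : W ⊆ V) (hWM : ∀ i ∈ W, s i ∈ M.map ν)
    (hcov : ∀ a ∈ M, ∃ T ⊆ W, ∏ i ∈ T, h.pre (s i) = a)
    (hZ : Nat.card A + p + #W ≤ #(V.filter fun i => s i ∈ M.map ν) + 2)
    (hV : #V + 2 = p * Nat.card A + Nat.card A + p)
    (hk : M = ⊥ ∨ Nat.card (A ⧸ M) + p ≤ #(V.filter fun i => χ (s i) ≠ 1) + 1) :
    ∃ T ⊆ V, #T = p * Nat.card A ∧ 1 ∈ famProds s T := by
  have hnorm := h.normal_map M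
  set Z := V.filter fun i => s i ∈ M.map ν with hZdef
  set O := V.filter fun i => s i ∉ M.map ν with hOdef
  have hZO : #Z + #O = #V := card_filter_add_card_filter_not _
  have hdZO : Disjoint Z O := disjoint_filter_filter_not _ _ _
  obtain ⟨Q, hQ, hQmax⟩ := exists_max_image
    (O.powerset.filter fun Q => ∃ g ∈ famProds s Q, g ∈ M.map ν) (fun Q => #Q)
    ⟨∅, by
      rw [mem_filter]
      exact ⟨by simp, 1, one_mem_famProds_empty s, one_mem _⟩⟩
  rw [mem_filter, mem_powerset] at hQ
  obtain ⟨hQO, g, hgQ, hgM⟩ := hQ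
  have hleft : #(O \ Q) + 2 ≤ Nat.card (A ⧸ M) + p := by
    by_contra hcon
    obtain ⟨I, hI, hIne, g', hg', hg'M⟩ := h.exists_nonempty_famProds_mem M s (O \ Q) (by omega)
    have hd : Disjoint Q I := disjoint_of_subset_right hI disjoint_sdiff
    have := hQmax (Q ∪ I) (by
      rw [mem_filter, mem_powerset]
      exact ⟨union_subset hQO (hI.trans sdiff_subset), g * g', mul_mem_famProds hd hgQ hg',
        mul_mem hgM hg'M⟩)
    rw [card_union_of_disjoint hd] at this
    have := card_pos.2 hIne
    omega
  have hOQ := card_sdiff_add_card_eq_card hQO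
  have hn := card_quot_le M
  have hWZ : W ⊆ Z := fun i hi => mem_filter.2 ⟨hWV hi, hWM i hi⟩
  have hZW := card_sdiff_add_card_eq_card hWZ
  obtain ⟨Z', hZ', hZ'c⟩ := exists_subset_card_eq (s := Z \ W) (n := p * Nat.card A - #Q - #W)
    (by omega)
  have hdQZ : Disjoint Q Z := (disjoint_of_subset_right hQO hdZO).symm
  have hdWZ' : Disjoint W Z' := disjoint_of_subset_right hZ' disjoint_sdiff
  have hdQW : Disjoint Q W := disjoint_of_subset_right hWZ hdQZ
  have hdQZ' : Disjoint Q Z' := disjoint_of_subset_right (hZ'.trans sdiff_subset) hdQZ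
  have hZν : ∀ i ∈ Z, ν (h.pre (s i)) = s i := fun i hi =>
    h.map_pre (h.chi_of_mem (mem_filter.1 hi).2)
  have hZM : ∀ i ∈ Z, h.pre (s i) ∈ M := fun i hi => h.pre_mem (mem_filter.1 hi).2
  have hZ'Z : Z' ⊆ Z := hZ'.trans sdiff_subset
  refine ⟨Q ∪ W ∪ Z', ?_, ?_, ?_⟩
  · exact union_subset (union_subset (hQO.trans (filter_subset _ _)) hWV)
      (hZ'Z.trans (filter_subset _ _))
  · rw [card_union_of_disjoint (by rw [disjoint_union_left]; exact ⟨hdQZ', hdWZ'⟩),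
      card_union_of_disjoint hdQW, hZ'c]
    omega
  · have hprod : ∀ S ⊆ Z, ν (∏ i ∈ S, h.pre (s i)) ∈ famProds s S := fun S hS =>
      map_prod_mem_famProds ν _ fun i hi => hZν i (hS hi)
    have hprodM : ∀ S ⊆ Z, ∏ i ∈ S, h.pre (s i) ∈ M := fun S hS =>
      M.prod_mem fun i hi => hZM i (hS hi)
    by_cases hMbot : M = ⊥
    · have h1 := mul_mem_famProds (by rw [disjoint_union_left]; exact ⟨hdQZ', hdWZ'⟩)
        (mul_mem_famProds hdQW hgQ (hprod W hWZ)) (hprod Z' hZ'Z)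
      have e1 := hprodM W hWZ
      have e2 := hprodM Z' hZ'Z
      rw [hMbot, Subgroup.mem_bot] at e1 e2
      rw [hMbot, Subgroup.map_bot, Subgroup.mem_bot] at hgM
      rw [e1, e2, hgM, map_one, one_mul, one_mul] at h1
      exact h1
    have hk' := hk.resolve_left hMbot
    obtain ⟨i, hiQ, hi⟩ : ∃ i ∈ Q, χ (s i) ≠ 1 := by
      by_contra hcon
      push Not at hcon
      have : (V.filter fun i => χ (s i) ≠ 1) ⊆ O \ Q := by
        intro i hi
        rw [mem_filter] at hi
        rw [mem_sdiff]
        exact ⟨mem_filter.2 ⟨hi.1, fun hm => hi.2 (h.chi_of_mem hm)⟩, fun hQ => hi.2 (hcon i hQ)⟩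
      have := card_le_card this
      omega
    obtain ⟨a, b, hab, hba⟩ := famProds_rotate hgQ hiQ
    obtain ⟨γ, hγ, hγg⟩ : s i * (b * a) ∈ M.map ν := by
      have := hnorm.conj_mem g hgM a⁻¹
      rw [hab] at this
      convert this using 1
      group
    set w := ∏ i ∈ W, h.pre (s i) with hw
    set z := ∏ i ∈ Z', h.pre (s i) with hz
    have hwM : w ∈ M := hprodM W hWZ
    have hzM : z ∈ M := hprodM Z' hZ'Z
    obtain ⟨x, hxM, hx⟩ := h.commHom_surj hi (M := M) (a := h.conj (s i) w * γ * z)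
      (mul_mem (mul_mem (h.conj_mem hwM _) hγ) hzM)
    obtain ⟨S, hS, hSx⟩ := hcov x hxM
    have hSy : ∏ i ∈ W \ S, h.pre (s i) = w * x⁻¹ := by
      rw [eq_mul_inv_iff_mul_eq, ← hSx, hw, prod_sdiff hS]
    have h1 := hprod S (hS.trans hWZ)
    have h2 := hprod (W \ S) (sdiff_subset.trans hWZ)
    rw [hSx] at h1
    rw [hSy] at h2
    have hdE : Disjoint (Q.erase i) Z' := disjoint_of_subset_left (erase_subset _ _) hdQZ'
    have h3 := mul_mem_famProds hdE hba (hprod Z' hZ'Z)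
    have hd4 : Disjoint (W \ S) (Q.erase i ∪ Z') := by
      rw [disjoint_union_right]
      exact ⟨disjoint_of_subset_left sdiff_subset
        (disjoint_of_subset_right (erase_subset _ _) hdQW.symm),
        disjoint_of_subset_left sdiff_subset hdWZ'⟩
    have h4 := mul_mem_famProds hd4 h2 h3
    have hiW : i ∉ W := fun hh => (disjoint_left.1 hdQW) hiQ hh
    have hiZ' : i ∉ Z' := fun hh => (disjoint_left.1 hdQZ') hiQ hh
    have h5 := cons_mem_famProds (i := i) (by
      simp only [mem_union, mem_sdiff, mem_erase]
      tauto) h4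
    have h6 := mul_mem_famProds (by
      rw [disjoint_insert_right, disjoint_union_right, disjoint_union_right]
      refine ⟨fun hh => hiW (hS hh), disjoint_sdiff, ?_, ?_⟩
      · exact disjoint_of_subset_left hS (disjoint_of_subset_right (erase_subset _ _) hdQW.symm)
      · exact disjoint_of_subset_left hS hdWZ') h1 h5
    convert h6 using 1
    · congr 1
      ext j
      simp only [mem_union, mem_insert, mem_sdiff, mem_erase]
      have hSj : j ∈ S → j ∈ W := fun hj => hS hj
      by_cases hj : j = i
      · simp [hj, hiQ]
      · tauto
    · rw [← hz]
      have : ν x * (s i * (ν (w * x⁻¹) * (b * a * ν z))) =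
          ν x * ((s i * ν (w * x⁻¹)) * (b * a) * ν z) := by simp only [mul_assoc]
      rw [this, h.mul_map (s i) (w * x⁻¹), mul_assoc (ν _) (s i), ← hγg, ← map_mul,
        ← map_mul, ← map_mul,
        eq_comm, map_mul (h.conj _), map_inv]
      have hx' : h.conj (s i) x = h.conj (s i) w * γ * z * x := by
        rw [← hx, h.commHom_apply, inv_mul_cancel_right]
      rw [← map_one ν]
      congr 1
      rw [hx']
      generalize hP : h.conj (s i) w * γ * z * x = P
      have : x * (h.conj (s i) w * P⁻¹ * γ * z) = h.conj (s i) w * γ * z * x * P⁻¹ := by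
        ac_rfl
      rw [this, hP, mul_inv_cancel]

theorem exists_subset_products [Finite A] (h : FrobeniusExt p χ ν) (s : ι → G) (V : Finset ι) :
    ∃ M : Subgroup A, ∃ W ⊆ V, (∀ i ∈ W, s i ∈ M.map ν) ∧
      (∀ a ∈ M, ∃ T ⊆ W, ∏ i ∈ T, h.pre (s i) = a) ∧ #W + 1 ≤ Nat.card M ∧
      (M = ⊤ ∨ #(V.filter fun i => χ (s i) = 1 ∧ s i ∉ M.map ν) + 1 < Nat.card (A ⧸ M)) := by
  obtain ⟨M, hM⟩ := (Set.toFinite {M : Subgroup A | ∃ W ⊆ V, (∀ i ∈ W, s i ∈ M.map ν) ∧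
      (∀ a ∈ M, ∃ T ⊆ W, ∏ i ∈ T, h.pre (s i) = a) ∧ #W + 1 ≤ Nat.card M}).exists_maximal
    ⟨⊥, ∅, by simp, by simp, by simp, by simp⟩
  obtain ⟨W, hWV, hWM, hcov, hWc⟩ := hM.1
  refine ⟨M, W, hWV, hWM, hcov, hWc, ?_⟩
  by_contra hcon
  push Not at hcon
  obtain ⟨hMtop, hcount⟩ := hcon
  obtain ⟨K, hMK, J, hJ, hJc, hJK, hJcov⟩ := exists_subgroup_cover_rel M hMtop
    (fun i => h.pre (s i)) (V.filter fun i => χ (s i) = 1 ∧ s i ∉ M.map ν) (by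
      intro j hj
      rw [mem_filter] at hj
      rw [← h.mem_map_iff_pre hj.2.1]
      exact hj.2.2) hcount
  have hd : Disjoint J W := by
    rw [disjoint_left]
    intro i hi hiW
    exact (mem_filter.1 (hJ hi)).2.2 (hWM i hiW)
  refine hMK.not_ge (hM.2 ⟨W ∪ J, union_subset hWV (hJ.trans (filter_subset _ _)), ?_, ?_, ?_⟩
    hMK.le)
  · intro i hi
    rcases mem_union.1 hi with hi | hi
    · exact Subgroup.map_mono hMK.le (hWM i hi)
    · rw [h.mem_map_iff_pre (mem_filter.1 (hJ hi)).2.1]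
      exact hJK i hi
  · intro a ha
    obtain ⟨T, hT, z, hz, hTz⟩ := hJcov _ (fun _ _ _ => Iff.rfl) a ha
    obtain ⟨T', hT', hTz'⟩ := hcov z hz
    refine ⟨T ∪ T', union_subset (hT.trans subset_union_right) (hT'.trans subset_union_left), ?_⟩
    rw [prod_union (disjoint_of_subset_left hT (disjoint_of_subset_right hT' hd)), hTz', hTz]
  · rw [card_union_of_disjoint hd.symm, ← hJc]
    nlinarith [Nat.card_pos (α := M)]

/-- The case where many elements of the family lie in `A`. -/
theorem exists_of_many_ker [Finite A] (h : FrobeniusExt p χ ν) (s : ι → G) (V : Finset ι)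
    (hV : #V + 2 = p * Nat.card A + Nat.card A + p)
    (hL : 2 * Nat.card A + p ≤ #(V.filter fun i => χ (s i) = 1) + 3) :
    ∃ T ⊆ V, #T = p * Nat.card A ∧ 1 ∈ famProds s T := by
  obtain ⟨M, W, hWV, hWM, hcov, hWc, hcount⟩ := h.exists_subset_products s V
  have hsplit : #(V.filter fun i => χ (s i) = 1) =
      #(V.filter fun i => s i ∈ M.map ν) + #(V.filter fun i => χ (s i) = 1 ∧ s i ∉ M.map ν) := by
    rw [← card_filter_add_card_filter_not (s := V.filter fun i => χ (s i) = 1)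
      (fun i => s i ∈ M.map ν), filter_filter, filter_filter]
    congr 2
    ext i
    simp only [mem_filter]
    exact ⟨fun hh => ⟨hh.1, hh.2.2⟩, fun hh => ⟨hh.1, h.chi_of_mem hh.2, hh.2⟩⟩
  have hk := card_filter_add_card_filter_not (s := V) (fun i => χ (s i) = 1)
  have hmn : Nat.card (A ⧸ M) * Nat.card M = Nat.card A := M.index_mul_card
  have hμ : 0 < Nat.card M := Nat.card_pos
  have hn : 0 < Nat.card (A ⧸ M) := Nat.card_pos
  have hsum : Nat.card (A ⧸ M) + Nat.card M ≤ Nat.card A + 1 := by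
    rw [← hmn]; nlinarith
  by_cases hcase : M = ⊥ ∨ Nat.card (A ⧸ M) + p ≤ #(V.filter fun i => χ (s i) ≠ 1) + 1
  · refine h.exists_of_subset_products M s V W hWV hWM hcov ?_ hV hcase
    rcases hcount with rfl | hcount
    · have : #(V.filter fun i => χ (s i) = 1 ∧ s i ∉ (⊤ : Subgroup A).map ν) = 0 := by
        rw [card_eq_zero, filter_eq_empty_iff]
        rintro i _ ⟨h1, h2⟩
        exact h2 ((h.mem_map_iff_pre h1).2 (Subgroup.mem_top _))
      rw [Subgroup.card_top] at hWc
      omega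
    · omega
  · push Not at hcase
    obtain ⟨hMbot, hkk⟩ := hcase
    have hμ2 : 2 ≤ Nat.card M := by
      have := Subgroup.card_eq_one (H := M)
      by_contra hcon
      exact hMbot (this.1 (by omega))
    obtain ⟨T, hT, hTc⟩ := h.exists_of_coset M s 1 (V.filter fun i => s i ∈ M.map ν) (by
      intro i hi
      simpa using (mem_filter.1 hi).2) (by
      rcases hcount with rfl | hcount
      · have : #(V.filter fun i => χ (s i) = 1 ∧ s i ∉ (⊤ : Subgroup A).map ν) = 0 := by
          rw [card_eq_zero, filter_eq_empty_iff]
          rintro i _ ⟨h1, h2⟩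
          exact h2 ((h.mem_map_iff_pre h1).2 (Subgroup.mem_top _))
        have h1 : Nat.card (A ⧸ (⊤ : Subgroup A)) = 1 := Subgroup.index_top
        rw [Subgroup.card_top] at *
        simp only [ne_eq] at *
        omega
      · have : 2 * Nat.card (A ⧸ M) + Nat.card M ≤ Nat.card A + 2 := by
          rw [← hmn]
          obtain ⟨x, hx⟩ := Nat.exists_eq_add_of_le hμ2
          obtain ⟨y, hy⟩ := Nat.exists_eq_add_of_le hn
          rw [hx, hy]
          nlinarith [Nat.zero_le (x * y)]
        simp only [ne_eq] at *
        omega)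
    exact ⟨T, hT.trans (filter_subset _ _), hTc⟩

/-- The products over `W` contain a translate of `M`. -/
def Covers (_ : FrobeniusExt p χ ν) (s : ι → G) (M : Subgroup A) (W : Finset ι) : Prop :=
  ∃ g, ∀ a ∈ M, ν a * g ∈ famProds s W

theorem covers_bot (h : FrobeniusExt p χ ν) (s : ι → G) : h.Covers s ⊥ ∅ := by
  refine ⟨1, fun a ha => ?_⟩
  rw [Subgroup.mem_bot] at ha
  simpa [ha] using one_mem_famProds_empty s

theorem chi_commutator (_ : FrobeniusExt p χ ν) (g g' : G) : χ (g * g' * g⁻¹ * g'⁻¹) = 1 := by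
  simp only [map_mul, map_inv]
  rw [mul_comm (χ g), mul_inv_cancel_right, mul_inv_cancel]

/-- The commutator of a pair of entries as an element of `A`. -/
noncomputable def pairComm (h : FrobeniusExt p χ ν) (s : ι → G) (e : ι × ι) : A :=
  h.pre (s e.1 * s e.2 * (s e.1)⁻¹ * (s e.2)⁻¹)

theorem map_pairComm (h : FrobeniusExt p χ ν) (s : ι → G) (e : ι × ι) :
    ν (h.pairComm s e) = s e.1 * s e.2 * (s e.1)⁻¹ * (s e.2)⁻¹ :=
  h.map_pre (h.chi_commutator _ _)

theorem pairComm_notMem (h : FrobeniusExt p χ ν) {s : ι → G} {e : ι × ι} {M : Subgroup A}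
    (he : s e.2 ∉ h.cent M (s e.1)) : h.pairComm s e ∉ M := by
  have := h.normal_map M
  intro hm
  apply he
  rw [h.mem_cent]
  rw [← h.mem_map, h.map_pairComm, ← QuotientGroup.eq_one_iff] at hm
  simp only [QuotientGroup.mk_mul, QuotientGroup.mk_inv] at hm
  rw [mul_inv_eq_one, mul_inv_eq_iff_eq_mul] at hm
  exact hm

theorem exists_pairs_products (h : FrobeniusExt p χ ν) (s : ι → G) (J : Finset (ι × ι)) :
    DisjPairs J → ∃ g, ∃ c : ι × ι → A, (∀ e ∈ J, ∃ x, c e = h.conj x (h.pairComm s e)) ∧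
      ∀ T ⊆ J, ν (∏ e ∈ T, c e) * g ∈ famProds s (pairSupp J) := by
  induction J using Finset.induction_on with
  | empty =>
    intro _
    refine ⟨1, fun _ => 1, by simp, fun T _ => ?_⟩
    simpa [pairSupp] using one_mem_famProds_empty s
  | insert e J he ih =>
    intro hJ
    obtain ⟨hJ', hne, hd⟩ := hJ.of_insert he
    obtain ⟨g, c, hc, hg⟩ := ih hJ'
    have hd' := hd
    rw [disjoint_insert_left, disjoint_singleton_left] at hd'
    refine ⟨s e.2 * s e.1 * g, fun e' => if e' = e then h.pairComm s e else
      h.conj (s e.2 * s e.1) (c e'), ?_, ?_⟩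
    · intro e' he'
      by_cases hee : e' = e
      · refine ⟨1, ?_⟩
        simp only [hee, if_true]
        rw [h.conj_one]
      · obtain ⟨x, hx⟩ := hc e' ((mem_insert.1 he').resolve_left hee)
        refine ⟨s e.2 * s e.1 * x, ?_⟩
        simp only [hee, if_false]
        rw [h.conj_mul _ x, hx]
    · intro T hT
      have hpair1 : s e.2 * s e.1 ∈ famProds s {e.1, e.2} := by
        have := cons_mem_famProds (s := s) (i := e.2) (I := {e.1}) (by simpa using hne.symm)
          (famProds_singleton s e.1)
        rwa [pair_comm] at this
      have hpair2 : s e.1 * s e.2 ∈ famProds s {e.1, e.2} :=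
        cons_mem_famProds (by simpa using hne) (famProds_singleton s e.2)
      have hrest : ∀ S ⊆ J, ∏ e' ∈ S, (if e' = e then h.pairComm s e else
          h.conj (s e.2 * s e.1) (c e')) = h.conj (s e.2 * s e.1) (∏ e' ∈ S, c e') := by
        intro S hS
        rw [map_prod]
        refine prod_congr rfl fun e' he' => ?_
        rw [if_neg]
        rintro rfl
        exact he (hS he')
      rw [pairSupp_insert]
      by_cases heT : e ∈ T
      · have hTe : T.erase e ⊆ J := by
          intro x hx
          rw [mem_erase] at hx
          exact (mem_insert.1 (hT hx.2)).resolve_left hx.1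
        have := mul_mem_famProds hd hpair2 (hg _ hTe)
        convert this using 1
        rw [← mul_prod_erase T _ heT, hrest _ hTe, if_pos rfl, map_mul, ← mul_assoc,
          mul_assoc (ν (h.pairComm s e)), ← h.mul_map, h.map_pairComm]
        group
      · have hTe : T ⊆ J := by
          intro x hx
          refine (mem_insert.1 (hT hx)).resolve_left ?_
          rintro rfl
          exact heT hx
        have := mul_mem_famProds hd hpair1 (hg _ hTe)
        convert this using 1
        rw [hrest _ hTe, ← mul_assoc (s e.2 * s e.1) (ν _) g, h.mul_map]
        simp only [mul_assoc]

theorem Covers.extend [Finite A] {h : FrobeniusExt p χ ν} {s : ι → G} {M : Subgroup A}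
    {W : Finset ι} (hcov : h.Covers s M W) (hM : M ≠ ⊤) {P : Finset (ι × ι)} (hP : DisjPairs P)
    (hPW : Disjoint (pairSupp P) W) (hPc : ∀ e ∈ P, s e.2 ∉ h.cent M (s e.1))
    (hPn : Nat.card (A ⧸ M) ≤ #P + 1) :
    ∃ K : Subgroup A, M < K ∧ ∃ J ⊆ P, (#J + 1) * Nat.card M = Nat.card K ∧
      h.Covers s K (pairSupp J ∪ W) := by
  obtain ⟨K, hMK, J, hJ, hJc, -, hJcov⟩ := exists_subgroup_cover_rel M hM (h.pairComm s) P
    (fun e he => h.pairComm_notMem (hPc e he)) hPn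
  obtain ⟨g, c, hc, hg⟩ := h.exists_pairs_products s J (hP.subset hJ)
  obtain ⟨g', hg'⟩ := hcov
  refine ⟨K, hMK, J, hJ, hJc, g * g', fun a ha => ?_⟩
  obtain ⟨T, hT, z, hz, hTz⟩ := hJcov c (by
    intro e he L
    obtain ⟨x, hx⟩ := hc e he
    rw [hx, h.conj_mem_iff]) a ha
  obtain ⟨y, hy, hyz⟩ := h.conj_surj g hz
  have := mul_mem_famProds (disjoint_of_subset_left (pairSupp_mono hJ) hPW) (hg T hT) (hg' y hy)
  convert this using 1
  rw [← hTz, ← hyz, map_mul, mul_assoc, mul_assoc, ← mul_assoc g, h.mul_map]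
  simp only [mul_assoc]

end
end FrobeniusExt

section
open scoped Classical

/-- A bijection between disjoint sets as a set of disjoint pairs. -/
theorem exists_disjPairs_of_disjoint {ι : Type*} {X Z : Finset ι} (hd : Disjoint X Z)
    (hc : #X = #Z) :
    ∃ P : Finset (ι × ι), DisjPairs P ∧ #P = #X ∧ ∀ e ∈ P, e.1 ∈ X ∧ e.2 ∈ Z := by
  let φ : X ≃ Z := equivOfCardEq hc
  have hinj : Function.Injective fun i : X => ((i : ι), (φ i : ι)) := fun i j hij =>
    Subtype.ext (congrArg Prod.fst hij)
  have hne : ∀ i j : X, (i : ι) ≠ φ j := fun i j =>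
    disjoint_iff_ne.1 hd _ i.2 _ (φ j).2
  refine ⟨univ.image fun i : X => ((i : ι), (φ i : ι)), ⟨?_, ?_⟩, ?_, ?_⟩
  · intro e he
    obtain ⟨i, -, rfl⟩ := mem_image.1 he
    exact hne i i
  · intro e he e' he' hee
    obtain ⟨i, -, rfl⟩ := mem_image.1 he
    obtain ⟨j, -, rfl⟩ := mem_image.1 he'
    have hij : i ≠ j := by
      rintro rfl
      exact hee rfl
    have h1 : (i : ι) ≠ j := fun h => hij (Subtype.ext h)
    have h2 : (φ i : ι) ≠ φ j := fun h => hij (φ.injective (Subtype.ext h))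
    simp only [Function.onFun, disjoint_insert_left, disjoint_singleton_left, mem_insert,
      mem_singleton, not_or]
    exact ⟨⟨h1, hne i j⟩, (hne j i).symm, h2⟩
  · rw [card_image_of_injective _ hinj, card_univ, Fintype.card_coe]
  · intro e he
    obtain ⟨i, -, rfl⟩ := mem_image.1 he
    exact ⟨i.2, (φ i).2⟩

/-- Every class misses at least `p - 1` members of the family. -/
def ClassBound {p : ℕ} {ι G : Type*} [Group G] (χ : G →* Multiplicative (ZMod p)) (s : ι → G)
    (V : Finset ι) : Prop :=
  ∀ e, p ≤ #(V.filter fun i => χ (s i) ≠ e) + 1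

theorem ClassBound.mono {p : ℕ} {ι G : Type*} [Group G] {χ : G →* Multiplicative (ZMod p)}
    {s : ι → G} {V V' : Finset ι} (h : ClassBound χ s V) (hV : V ⊆ V') : ClassBound χ s V' :=
  fun e => (h e).trans (Nat.succ_le_succ (card_le_card (filter_subset_filter _ hV)))

theorem classBound_of_pairs {p : ℕ} {ι G : Type*} [Group G] {χ : G →* Multiplicative (ZMod p)}
    {s : ι → G} {V : Finset ι} {P : Finset (ι × ι)} (hP : DisjPairs P)
    (hPc : ∀ e ∈ P, χ (s e.1) ≠ χ (s e.2)) (hp : p ≤ #P + 1) (hPV : pairSupp P ⊆ V) :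
    ClassBound χ s V := by
  intro c
  refine hp.trans (Nat.succ_le_succ ?_)
  have key : ∀ e : ι × ι, (if χ (s e.1) ≠ c then e.1 else e.2) ∈ ({e.1, e.2} : Finset ι) := by
    intro e
    split_ifs <;> simp
  refine card_le_card_of_injOn (fun e => if χ (s e.1) ≠ c then e.1 else e.2) ?_ ?_
  · intro e he
    refine mem_filter.2 ⟨hPV (mem_biUnion.2 ⟨e, he, key e⟩), ?_⟩
    by_cases hc : χ (s e.1) = c
    · have := hPc e he
      simp only [hc, ne_eq, not_true_eq_false, if_false]
      rw [hc] at this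
      exact this.symm
    · simp [hc]
  · intro e he e' he' hee
    by_contra hne
    refine disjoint_left.1 (hP.2 he he' hne) (key e) ?_
    have hee' : (if χ (s e.1) ≠ c then e.1 else e.2) =
      if χ (s e'.1) ≠ c then e'.1 else e'.2 := hee
    rw [hee']
    exact key e'

theorem exists_class_pairs {p : ℕ} {ι G : Type*} [Group G] {χ : G →* Multiplicative (ZMod p)}
    {s : ι → G} {V : Finset ι} (hp : 0 < p) (h : ClassBound χ s V) (hV : 2 * p ≤ #V + 2) :
    ∃ P, DisjPairs P ∧ #P + 1 = p ∧ pairSupp P ⊆ V ∧ ∀ e ∈ P, χ (s e.1) ≠ χ (s e.2) := by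
  obtain ⟨P, h1, h2, h3, h4⟩ := exists_pairs (fun i => χ (s i)) (p - 1) V (by omega)
    (fun c => by
      refine Nat.sub_le_of_le_add ?_
      convert h c)
  exact ⟨P, h1, by omega, h3, h4⟩

end

namespace FrobeniusExt

section
open scoped Classical
variable {p : ℕ} {ι G A : Type*} [Group G] [CommGroup A]
  {χ : G →* Multiplicative (ZMod p)} {ν : A →* G}

theorem exists_of_not_classBound [Finite A] (h : FrobeniusExt p χ ν) (s : ι → G) (V : Finset ι)
    (hV : #V + 2 = p * Nat.card A + Nat.card A + p) (hc : ¬ ClassBound χ s V) :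
    ∃ T ⊆ V, #T = p * Nat.card A ∧ 1 ∈ famProds s T := by
  unfold ClassBound at hc
  push Not at hc
  obtain ⟨e, he⟩ := hc
  have hsplit := card_filter_add_card_filter_not (s := V) (fun i => χ (s i) = e)
  have hA : 0 < Nat.card A := Nat.card_pos
  have hp := h.prime.pos
  simp only [ne_eq] at he
  obtain ⟨i₀, hi₀⟩ : (V.filter fun i => χ (s i) = e).Nonempty := by
    rw [← card_pos]
    have : 0 < p * Nat.card A := Nat.mul_pos hp hA
    omega
  obtain ⟨T, hT, hTc⟩ := h.exists_of_coset ⊤ s (s i₀) (V.filter fun i => χ (s i) = e) (by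
    intro i hi
    rw [h.mem_map_iff_pre]
    · exact Subgroup.mem_top _
    · rw [map_mul, map_inv, (mem_filter.1 hi).2, (mem_filter.1 hi₀).2, inv_mul_cancel]) (by
    rw [Subgroup.card_top]
    omega)
  exact ⟨T, hT.trans (filter_subset _ _), hTc⟩

theorem exists_of_covers_top [Finite A] (h : FrobeniusExt p χ ν) (s : ι → G) (V W : Finset ι)
    (hWV : W ⊆ V) (hV : #V + 2 = p * Nat.card A + Nat.card A + p)
    (hW : #W + 2 ≤ 2 * Nat.card A) (hcov : h.Covers s ⊤ W) (hc : ClassBound χ s (V \ W)) :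
    ∃ T ⊆ V, #T = p * Nat.card A ∧ 1 ∈ famProds s T := by
  have := Fact.mk h.prime
  have hp := h.prime.two_le
  have hA : 0 < Nat.card A := Nat.card_pos
  have hVW := card_sdiff_add_card_eq_card hWV
  have hpA : 2 * Nat.card A + p ≤ p * Nat.card A + 2 := by
    obtain ⟨q, rfl⟩ := Nat.exists_eq_add_of_le hp
    obtain ⟨a, ha⟩ := Nat.exists_eq_add_of_le hA
    rw [ha]
    nlinarith [Nat.zero_le (q * a)]
  obtain ⟨P, hP, hPc, hPV, hPne⟩ := exists_class_pairs h.prime.pos hc (by omega)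
  have hPs := hP.card_pairSupp
  have hVP := card_sdiff_add_card_eq_card hPV
  obtain ⟨D₂, hD₂, hD₂c⟩ := exists_subset_card_eq (s := (V \ W) \ pairSupp P)
    (n := Nat.card A - 1) (by omega)
  obtain ⟨D₁, hD₁, hD₁c, hD₁s⟩ := exists_transversal_sum (fun i => (χ (s i)).toAdd) P hP
    (fun e he => fun hee => hPne e he (Multiplicative.toAdd.injective hee)) (by omega)
    (∑ i ∈ V, (χ (s i)).toAdd - ∑ i ∈ D₂, (χ (s i)).toAdd)
  have hd : Disjoint D₁ D₂ :=
    disjoint_of_subset_left hD₁ (disjoint_of_subset_right hD₂ disjoint_sdiff)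
  have hDVW : D₁ ∪ D₂ ⊆ V \ W :=
    union_subset (hD₁.trans hPV) (hD₂.trans sdiff_subset)
  have hDV : D₁ ∪ D₂ ⊆ V := hDVW.trans sdiff_subset
  have hDc := card_union_of_disjoint hd
  have hTc := card_sdiff_add_card_eq_card hDV
  have hchi : ∏ i ∈ V \ (D₁ ∪ D₂), χ (s i) = 1 := by
    have h1 := sum_sdiff (f := fun i => (χ (s i)).toAdd) hDV
    rw [sum_union hd, hD₁s, sub_add_cancel, add_eq_right] at h1
    apply Multiplicative.toAdd.injective
    rw [toAdd_prod, h1, toAdd_one]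
  have hWT : W ⊆ V \ (D₁ ∪ D₂) := fun i hi => mem_sdiff.2 ⟨hWV hi, fun hiD =>
    (mem_sdiff.1 (hDVW hiD)).2 hi⟩
  obtain ⟨u, hu⟩ := famProds_nonempty s ((V \ (D₁ ∪ D₂)) \ W)
  obtain ⟨g, hg⟩ := hcov
  have hmem : ∀ a, u * (ν a * g) ∈ famProds s (V \ (D₁ ∪ D₂)) := by
    intro a
    have := mul_mem_famProds sdiff_disjoint hu (hg a (Subgroup.mem_top a))
    rwa [sdiff_union_of_subset hWT] at this
  have hug : χ (u * g) = 1 := by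
    rw [← hchi, ← map_eq_prod_of_mem_famProds χ (hmem 1)]
    simp
  obtain ⟨a, -, ha⟩ := h.conj_surj (M := ⊤) u (a := (h.pre (u * g))⁻¹) (Subgroup.mem_top _)
  refine ⟨V \ (D₁ ∪ D₂), sdiff_subset, by omega, ?_⟩
  convert hmem a using 1
  rw [← mul_assoc, h.mul_map, ha, mul_assoc, map_inv, h.map_pre hug, inv_mul_cancel]

/-- A maximal subgroup covered by few members of a family. -/
theorem exists_maximal_covers [Finite A] (h : FrobeniusExt p χ ν) (s : ι → G) (V : Finset ι)
    (hc : ClassBound χ s V) :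
    ∃ M : Subgroup A, ∃ W ⊆ V, #W + 2 ≤ 2 * Nat.card M ∧ h.Covers s M W ∧
      ClassBound χ s (V \ W) ∧ (M = ⊤ ∨ ∀ P, DisjPairs P → pairSupp P ⊆ V \ W →
        (∀ e ∈ P, s e.2 ∉ h.cent M (s e.1)) → Nat.card (A ⧸ M) ≤ #P + 1 →
          ¬ ClassBound χ s ((V \ W) \ pairSupp P)) := by
  obtain ⟨M, hM⟩ := (Set.toFinite {M : Subgroup A | ∃ W ⊆ V, #W + 2 ≤ 2 * Nat.card M ∧
      h.Covers s M W ∧ ClassBound χ s (V \ W)}).exists_maximal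
    ⟨⊥, ∅, by simp, by simp, h.covers_bot s, by simpa using hc⟩
  obtain ⟨W, hWV, hW, hcov, hcW⟩ := hM.1
  refine ⟨M, W, hWV, hW, hcov, hcW, ?_⟩
  by_contra! hcon
  obtain ⟨hMt, P, hP, hPV, hPc, hPn, hPb⟩ := hcon
  obtain ⟨K, hMK, J, hJ, hJc, hJcov⟩ := hcov.extend hMt hP
    (disjoint_of_subset_left hPV sdiff_disjoint) hPc hPn
  have hJP := pairSupp_mono hJ
  refine hMK.not_ge (hM.2 ⟨pairSupp J ∪ W, ?_, ?_, hJcov, ?_⟩ hMK.le)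
  · exact union_subset ((hJP.trans hPV).trans sdiff_subset) hWV
  · have h1 := card_union_le (pairSupp J) W
    rw [(hP.subset hJ).card_pairSupp] at h1
    have hM0 : 0 < Nat.card M := Nat.card_pos
    have : (#J + 1) * Nat.card M = #J * Nat.card M + Nat.card M := by ring
    have : #J ≤ #J * Nat.card M := Nat.le_mul_of_pos_right _ hM0
    omega
  · refine hPb.mono fun i hi => ?_
    simp only [mem_sdiff, mem_union] at hi ⊢
    exact ⟨hi.1.1, fun hi' => hi'.elim (fun h => hi.2 (hJP h)) hi.1.2⟩

/-- Members outside the centralizer paired with noncentral members inside. -/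
theorem exists_pairs_cent [Finite A] (h : FrobeniusExt p χ ν) {M : Subgroup A} {s : ι → G} {f : G}
    (hf : f ∉ M.map ν) {t : ℕ} {X Z : Finset ι} (hX : ∀ i ∈ X, s i ∉ h.cent M f)
    (hZ : ∀ i ∈ Z, s i ∈ h.cent M f ∧ s i ∉ M.map ν) (hXc : t ≤ #X) (hZc : t ≤ #Z) :
    ∃ P, DisjPairs P ∧ #P = t ∧ pairSupp P ⊆ X ∪ Z ∧ ∀ e ∈ P, s e.2 ∉ h.cent M (s e.1) := by
  obtain ⟨X', hX', hX'c⟩ := exists_subset_card_eq hXc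
  obtain ⟨Z', hZ', hZ'c⟩ := exists_subset_card_eq hZc
  have hd : Disjoint X' Z' := disjoint_left.2 fun i hi hi' => hX i (hX' hi) (hZ i (hZ' hi')).1
  obtain ⟨P, hP, hPc, hPe⟩ := exists_disjPairs_of_disjoint hd (hX'c.trans hZ'c.symm)
  refine ⟨P, hP, hPc.trans hX'c, ?_, ?_⟩
  · intro i hi
    obtain ⟨e, he, rfl | rfl⟩ := mem_pairSupp.1 hi
    · exact mem_union_left _ (hX' (hPe e he).1)
    · exact mem_union_right _ (hZ' (hPe e he).2)
  · intro e he hc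
    have h1 := hX _ (hX' (hPe e he).1)
    obtain ⟨h2, h3⟩ := hZ _ (hZ' (hPe e he).2)
    have h4 : s e.1 ∉ M.map ν := fun hm => h1 (h.map_le_cent f hm)
    rw [h.cent_eq_of_mem hf h3 h2, ← h.cent_eq_of_mem h4 h3 hc] at h1
    exact h1 (h.self_mem_cent _)

/-- Repeated extraction of product-one subfamilies with entries in a subgroup. -/
theorem exists_of_mem_subgroup {H : Subgroup G} {N d : ℕ}
    (hH : ∀ (s : ι → H) (V : Finset ι), #V = N + d → ∃ T ⊆ V, #T = N ∧ 1 ∈ famProds s T)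
    (s : ι → G) (j : ℕ) : ∀ V : Finset ι, (∀ i ∈ V, s i ∈ H) → N * j + d ≤ #V →
      ∃ T ⊆ V, #T = N * j ∧ 1 ∈ famProds s T := by
  induction j with
  | zero => exact fun V _ _ => ⟨∅, by simp, by simp, one_mem_famProds_empty s⟩
  | succ j ih =>
    intro V hVH hV
    rw [Nat.mul_succ] at hV
    obtain ⟨U, hU, hUc⟩ := exists_subset_card_eq (s := V) (n := N + d) (by omega)
    obtain ⟨T₁, hT₁, hT₁c, h1⟩ := hH (fun i => if hi : s i ∈ H then ⟨s i, hi⟩ else 1) U hUc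
    have h1' := map_mem_famProds H.subtype h1
    rw [map_one, famProds_congr (s' := s) (fun i hi => by
      simp [hVH i (hU (hT₁ hi))])] at h1'
    have hc := card_sdiff_add_card_eq_card (hT₁.trans hU)
    obtain ⟨T₂, hT₂, hT₂c, h2⟩ := ih (V \ T₁) (fun i hi => hVH i (sdiff_subset hi)) (by omega)
    have hd : Disjoint T₁ T₂ := disjoint_of_subset_right hT₂ disjoint_sdiff
    refine ⟨T₁ ∪ T₂, union_subset (hT₁.trans hU) (hT₂.trans sdiff_subset), ?_, ?_⟩
    · rw [card_union_of_disjoint hd, hT₁c, hT₂c, Nat.mul_succ, add_comm]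
    · simpa using mul_mem_famProds hd h1' h2

theorem card_inequalities {p n k m : ℕ} (hp : 2 ≤ p) (hn : p + 1 ≤ n) (hk : k = 1 ∨ p + 1 ≤ k)
    (hm : m = n * k) :
    n ≤ m ∧ k ≤ m ∧ 3 * k + n ≤ m + 4 ∧ 2 * k + n ≤ m + 2 ∧ k + n ≤ m + 1 ∧
      (2 ≤ k → 2 * k + 2 * n ≤ m + 3) ∧ 2 * m + 4 * p ≤ p * m + 8 := by
  have hk0 : 1 ≤ k := by omega
  obtain ⟨a, rfl⟩ := Nat.exists_eq_add_of_le (show 3 ≤ n by omega)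
  obtain ⟨b, rfl⟩ := Nat.exists_eq_add_of_le hk0
  have hmn : 3 + a ≤ m := by nlinarith
  refine ⟨by nlinarith, by nlinarith, by nlinarith, by nlinarith, by nlinarith, ?_, ?_⟩
  · intro _
    obtain ⟨c, rfl⟩ := Nat.exists_eq_add_of_le (show 2 ≤ b by omega)
    nlinarith
  · obtain ⟨q, rfl⟩ := Nat.exists_eq_add_of_le hp
    rcases Nat.eq_zero_or_pos q with rfl | hq
    · omega
    · obtain ⟨c, hc⟩ := Nat.exists_eq_add_of_le (show 4 ≤ m by omega)
      rw [hc]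
      nlinarith

theorem card_inequalities_of_ne_top [Finite A] (h : FrobeniusExt p χ ν) {M : Subgroup A}
    (hM : M ≠ ⊤) {m n k : ℕ} (hm : Nat.card A = m) (hn : Nat.card (A ⧸ M) = n)
    (hk : Nat.card M = k) :
    3 ≤ n ∧ 1 ≤ k ∧ n ≤ m ∧ k ≤ m ∧ 3 * k + n ≤ m + 4 ∧ 2 * k + n ≤ m + 2 ∧ k + n ≤ m + 1 ∧
      (2 ≤ k → 2 * k + 2 * n ≤ m + 3) ∧ 2 * m + 4 * p ≤ p * m + 8 ∧ (k = 1 → n = m) := by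
  have hp := h.prime.two_le
  have hmul : m = n * k := by
    rw [← hm, ← hn, ← hk]
    exact Subgroup.card_eq_card_quotient_mul_card_subgroup M
  have hn1 : n ≠ 1 := by
    rw [← hn]
    intro hc
    exact hM (Subgroup.index_eq_one.1 hc)
  have hpn : p < n := h.lt n (hm ▸ hmul ▸ Dvd.intro _ rfl) hn1
  have hk' : k = 1 ∨ p + 1 ≤ k := by
    by_cases hk1 : k = 1
    · exact Or.inl hk1
    · exact Or.inr (h.lt k (hm ▸ hmul ▸ Dvd.intro_left _ rfl) hk1)
  have := card_inequalities hp hpn hk' hmul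
  refine ⟨by omega, by omega, this.1, this.2.1, this.2.2.1, this.2.2.2.1, this.2.2.2.2.1,
    this.2.2.2.2.2.1, this.2.2.2.2.2.2, ?_⟩
  rintro rfl
  rw [hmul, mul_one]

/-- The case that almost all members of a family centralize `f` modulo `M`. -/
theorem exists_of_cent [Finite A] (h : FrobeniusExt p χ ν) {M : Subgroup A} (hM : M ≠ ⊤)
    {s : ι → G} {V : Finset ι} {f : G} (hf : χ f ≠ 1)
    (hV : p * Nat.card A + Nat.card A + p ≤ #V + 2 * Nat.card M)
    (hc : ClassBound χ s V)
    (hmax : ∀ P, DisjPairs P → pairSupp P ⊆ V → (∀ e ∈ P, s e.2 ∉ h.cent M (s e.1)) →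
      Nat.card (A ⧸ M) ≤ #P + 1 → ¬ ClassBound χ s (V \ pairSupp P))
    (hIH : ∀ (s : ι → h.cent M f) (V : Finset ι),
      #V + 2 = p * Nat.card M + Nat.card M + p →
      ∃ T ⊆ V, #T = p * Nat.card M ∧ 1 ∈ famProds s T)
    (hL : #(V.filter fun i => χ (s i) = 1) + 4 ≤ 2 * Nat.card A + p)
    (hL1 : Nat.card M = 1 → #(V.filter fun i => s i ∈ M.map ν) + 3 ≤ Nat.card A + p)
    (hω : #(V.filter fun i => s i ∉ h.cent M f) + 4 ≤ Nat.card (A ⧸ M) + 2 * p) :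
    ∃ T ⊆ V, #T = p * Nat.card A ∧ 1 ∈ famProds s T := by
  have hp := h.prime.two_le
  have hmul : p * Nat.card A = p * Nat.card M * Nat.card (A ⧸ M) := by
    rw [Subgroup.card_eq_card_quotient_mul_card_subgroup M]
    ring
  obtain ⟨m, hm⟩ : ∃ m, Nat.card A = m := ⟨_, rfl⟩
  obtain ⟨n, hn⟩ : ∃ n, Nat.card (A ⧸ M) = n := ⟨_, rfl⟩
  obtain ⟨k, hk⟩ : ∃ k, Nat.card M = k := ⟨_, rfl⟩
  obtain ⟨hn3, hk1, hnm, hkm, i1, i2, i3, i4, i5, i6⟩ := h.card_inequalities_of_ne_top hM hm hn hk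
  rw [hm] at hV hL hL1 hmul ⊢
  rw [hn] at hω hmul hmax
  rw [hk] at hV hL1 hmul
  simp only [hk] at hIH
  have hfM : f ∉ M.map ν := fun hfM => hf (h.chi_of_mem hfM)
  set VH := V.filter fun i => s i ∈ h.cent M f with hVH
  set VO := V.filter fun i => s i ∉ h.cent M f with hVO
  have hsplit : #VH + #VO = #V := card_filter_add_card_filter_not _
  by_cases hω' : #VO + 2 ≤ n
  · obtain ⟨T, hT, hTc⟩ := exists_of_mem_subgroup (N := p * k) (d := k + p - 2)
      (fun s V hV => hIH s V (by omega)) s n VH (fun i hi => (mem_filter.1 hi).2) (by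
        rw [← hmul]
        omega)
    exact ⟨T, hT.trans (filter_subset _ _), hmul ▸ hTc⟩
  have hML : #(V.filter fun i => s i ∈ M.map ν) ≤ #(V.filter fun i => χ (s i) = 1) :=
    card_le_card (monotone_filter_right _ fun i _ => h.chi_of_mem)
  have hVHM : #V ≤ #(VH.filter fun i => s i ∉ M.map ν) + #VO +
      #(V.filter fun i => s i ∈ M.map ν) := by
    have h1 := card_filter_add_card_filter_not (s := VH) (fun i => s i ∈ M.map ν)
    have h2 : #(VH.filter fun i => s i ∈ M.map ν) ≤ #(V.filter fun i => s i ∈ M.map ν) :=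
      card_le_card (filter_subset_filter _ (filter_subset _ _))
    omega
  have hsub : VH ⊆ V := filter_subset _ _
  have hsubO : VO ⊆ V := filter_subset _ _
  by_cases hcH : ClassBound χ s VH
  · exfalso
    obtain ⟨Y, hY, hYc, hYV, hYe⟩ := exists_class_pairs h.prime.pos hcH (by
      have : #(VH.filter fun i => s i ∉ M.map ν) ≤ #VH := card_filter_le _ _
      by_cases hk2 : k = 1
      · have := i6 hk2
        have := hL1 hk2
        omega
      · have := i4 (by omega)
        omega)
    have hYs := hY.card_pairSupp
    set Z := (VH.filter fun i => s i ∉ M.map ν) \ pairSupp Y with hZdef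
    have hZc : #(VH.filter fun i => s i ∉ M.map ν) ≤ #Z + #(pairSupp Y) :=
      card_le_card_sdiff_add_card
    obtain ⟨P, hP, hPc, hPs, hPe⟩ := h.exists_pairs_cent (t := n - 1) hfM (X := VO) (Z := Z)
      (fun i hi => (mem_filter.1 hi).2)
      (fun i hi => by
        have h1 := mem_filter.1 (mem_sdiff.1 hi).1
        exact ⟨(mem_filter.1 h1.1).2, h1.2⟩) (by omega) (by
        by_cases hk2 : k = 1
        · have := i6 hk2
          have := hL1 hk2
          omega
        · have := i4 (by omega)
          omega)
    refine hmax P hP (hPs.trans (union_subset hsubO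
      (sdiff_subset.trans ((filter_subset _ _).trans hsub)))) hPe (by omega) ?_
    refine classBound_of_pairs hY hYe (by omega) fun i hi => ?_
    refine mem_sdiff.2 ⟨hsub (hYV hi), fun hiP => ?_⟩
    rcases mem_union.1 (hPs hiP) with hi' | hi'
    · exact (mem_filter.1 hi').2 (mem_filter.1 (hYV hi)).2
    · exact (mem_sdiff.1 hi').2 hi
  unfold ClassBound at hcH
  push Not at hcH
  obtain ⟨e, he⟩ := hcH
  simp only [ne_eq] at he
  set F := VH.filter fun i => χ (s i) = e with hF
  set R := VH.filter fun i => ¬ χ (s i) = e with hR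
  have hFR : #F + #R = #VH := card_filter_add_card_filter_not _
  have hi24 : 2 * k + 2 * n ≤ m + 3 ∨ k = 1 := by
    by_cases hk2 : k = 1
    · exact Or.inr hk2
    · exact Or.inl (i4 (by omega))
  by_cases he1 : e = 1
  · exfalso
    have : #F ≤ #(V.filter fun i => χ (s i) = 1) := by
      rw [hF, he1]
      exact card_le_card (filter_subset_filter _ hsub)
    omega
  obtain ⟨i₀, hi₀⟩ : F.Nonempty := by
    rw [← card_pos]
    omega
  have hFcoset : ∀ i ∈ F, (s i₀)⁻¹ * s i ∈ M.map ν := by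
    intro i hi
    rw [hF, mem_filter, hVH, mem_filter] at hi hi₀
    refine h.mem_of_mem_cent hf ?_ (mul_mem (inv_mem hi₀.1.2) hi.1.2)
    rw [map_mul, map_inv, hi.2, hi₀.2, inv_mul_cancel]
  have hFV : F ⊆ V := (filter_subset _ _).trans hsub
  by_cases hFc : p * m + k ≤ #F + 1
  · obtain ⟨T, hT, hTc⟩ := h.exists_of_coset M s (s i₀) F hFcoset (by rw [hm, hk]; exact hFc)
    rw [hm] at hTc
    exact ⟨T, hT.trans hFV, hTc⟩
  exfalso
  have hRN : R ⊆ V.filter fun i => χ (s i) ≠ e := by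
    intro i hi
    rw [hR, mem_filter] at hi
    exact mem_filter.2 ⟨hsub hi.1, hi.2⟩
  obtain ⟨Q, hRQ, hQ, hQc⟩ := exists_subsuperset_card_eq (n := p - 1) hRN (by omega) (by
    have := hc e
    omega)
  have hFp : n + p ≤ #F + 2 := by omega
  obtain ⟨F', hF', hF'c⟩ := exists_subset_card_eq (s := F) (n := p - 1) (by omega)
  have hXc : #VO ≤ #(VO \ Q) + (p - 1 - #R) := by
    have h1 : VO \ Q = VO \ (Q \ R) := by
      ext i
      simp only [mem_sdiff, not_and, not_not]
      refine and_congr_right fun hi => ⟨fun h1 h2 => (h1 h2).elim, fun h1 h2 => ?_⟩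
      exact (mem_filter.1 hi).2 (mem_filter.1 (mem_filter.1 (h1 h2)).1).2
    have h2 := card_sdiff_add_card_eq_card hRQ
    have h3 := le_card_sdiff (Q \ R) VO
    rw [h1]
    omega
  have hZc := card_sdiff_add_card_eq_card hF'
  obtain ⟨P, hP, hPc, hPs, hPe⟩ := h.exists_pairs_cent (t := n - 1) hfM (X := VO \ Q)
    (Z := F \ F')
    (fun i hi => (mem_filter.1 (mem_sdiff.1 hi).1).2)
    (fun i hi => by
      have h1 := mem_filter.1 (mem_sdiff.1 hi).1
      exact ⟨(mem_filter.1 h1.1).2, fun hiM => he1 (h1.2 ▸ h.chi_of_mem hiM)⟩) (by omega) (by omega)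
  refine hmax P hP (hPs.trans (union_subset (sdiff_subset.trans hsubO)
    (sdiff_subset.trans hFV))) hPe (by omega) ?_
  have hFd : ∀ i ∈ F', i ∈ V \ pairSupp P := by
    intro i hi
    refine mem_sdiff.2 ⟨hFV (hF' hi), fun hiP => ?_⟩
    rcases mem_union.1 (hPs hiP) with hi' | hi'
    · exact (mem_filter.1 (mem_sdiff.1 hi').1).2 (mem_filter.1 (mem_filter.1 (hF' hi)).1).2
    · exact (mem_sdiff.1 hi').2 hi
  have hQd : ∀ i ∈ Q, i ∈ V \ pairSupp P := by
    intro i hi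
    refine mem_sdiff.2 ⟨(mem_filter.1 (hQ hi)).1, fun hiP => ?_⟩
    rcases mem_union.1 (hPs hiP) with hi' | hi'
    · exact (mem_sdiff.1 hi').2 hi
    · exact (mem_filter.1 (hQ hi)).2 (mem_filter.1 (mem_sdiff.1 hi').1).2
  intro c
  by_cases hce : c = e
  · have : #Q ≤ #((V \ pairSupp P).filter fun i => χ (s i) ≠ c) := card_le_card fun i hi =>
      mem_filter.2 ⟨hQd i hi, hce ▸ (mem_filter.1 (hQ hi)).2⟩
    omega
  · have : #F' ≤ #((V \ pairSupp P).filter fun i => χ (s i) ≠ c) := card_le_card fun i hi =>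
      mem_filter.2 ⟨hFd i hi, by
        rw [(mem_filter.1 (hF' hi)).2]
        exact Ne.symm hce⟩
    omega

theorem exists_of_maximal_covers [Finite A] (h : FrobeniusExt p χ ν) {M : Subgroup A} (hM : M ≠ ⊤)
    {s : ι → G} {V W : Finset ι} (hWV : W ⊆ V) (hV : #V + 2 = p * Nat.card A + Nat.card A + p)
    (hW : #W + 2 ≤ 2 * Nat.card M) (hc : ClassBound χ s (V \ W))
    (hmax : ∀ P, DisjPairs P → pairSupp P ⊆ V \ W → (∀ e ∈ P, s e.2 ∉ h.cent M (s e.1)) →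
      Nat.card (A ⧸ M) ≤ #P + 1 → ¬ ClassBound χ s ((V \ W) \ pairSupp P))
    (hIH : ∀ f, χ f ≠ 1 → ∀ (s : ι → h.cent M f) (V : Finset ι),
      #V + 2 = p * Nat.card M + Nat.card M + p →
      ∃ T ⊆ V, #T = p * Nat.card M ∧ 1 ∈ famProds s T) :
    ∃ T ⊆ V, #T = p * Nat.card A ∧ 1 ∈ famProds s T := by
  by_contra hno
  have hp := h.prime.two_le
  have hL : #(V.filter fun i => χ (s i) = 1) + 4 ≤ 2 * Nat.card A + p := by
    by_contra hcon
    exact hno (h.exists_of_many_ker s V hV (by omega))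
  have hL1 : Nat.card M = 1 → #(V.filter fun i => s i ∈ M.map ν) + 3 ≤ Nat.card A + p := by
    intro hM1
    by_contra hcon
    have hb := Subgroup.card_eq_one.1 hM1
    refine hno (h.exists_of_subset_products M s V ∅ (by simp) (by simp)
      (fun a ha => ⟨∅, by simp, ?_⟩)
      (by rw [card_empty]; omega) hV (Or.inl hb))
    rw [hb, Subgroup.mem_bot] at ha
    simp [ha]
  have hineq := h.card_inequalities_of_ne_top hM rfl rfl rfl
  obtain ⟨hn3, hk1, hnm, hkm, i1, i2, i3, i4, i5, i6⟩ := hineq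
  have hVW := card_sdiff_add_card_eq_card hWV
  obtain ⟨Y, hY, hYc, hYV, hYe⟩ := exists_class_pairs h.prime.pos hc (by omega)
  have hYs := hY.card_pairSupp
  set V₀ := (V \ W) \ pairSupp Y with hV₀
  have hV₀c : #V₀ + #(pairSupp Y) = #(V \ W) := card_sdiff_add_card_eq_card hYV
  have hV₀V : V₀ ⊆ V := sdiff_subset.trans sdiff_subset
  have hML : #(V.filter fun i => s i ∈ M.map ν) ≤ #(V.filter fun i => χ (s i) = 1) :=
    card_le_card (monotone_filter_right _ fun i _ => h.chi_of_mem)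
  set U := V₀.filter fun i => s i ∉ M.map ν with hU
  have hUc : #V₀ ≤ #U + #(V.filter fun i => s i ∈ M.map ν) := by
    have h1 : #(V₀.filter fun i => s i ∈ M.map ν) + #U = #V₀ :=
      card_filter_add_card_filter_not _
    have h2 : #(V₀.filter fun i => s i ∈ M.map ν) ≤ #(V.filter fun i => s i ∈ M.map ν) :=
      card_le_card (filter_subset_filter _ hV₀V)
    omega
  have hUlarge : 2 * (Nat.card (A ⧸ M) - 1) ≤ #U := by
    by_contra hcon
    by_cases hk2 : Nat.card M = 1
    · have := i6 hk2
      have := hL1 hk2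
      omega
    · have := i4 (by omega)
      omega
  obtain ⟨c, hcol⟩ : ∃ c, #(U.filter fun i => h.cent M (s i) ≠ c) < Nat.card (A ⧸ M) - 1 := by
    by_contra! hcon
    obtain ⟨P, hP, hPc, hPU, hPe⟩ := exists_pairs (fun i => h.cent M (s i)) _ U hUlarge hcon
    have hPV : pairSupp P ⊆ V₀ := hPU.trans (filter_subset _ _)
    refine hmax P hP (hPV.trans sdiff_subset) ?_ (by omega)
      (classBound_of_pairs hY hYe (by omega) fun i hi => mem_sdiff.2 ⟨hYV hi, fun hiP =>
        (mem_sdiff.1 (hPV hiP)).2 hi⟩)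
    intro e he hce
    exact hPe e he (h.cent_eq_of_mem
      (mem_filter.1 (hPU (mem_pairSupp.2 ⟨e, he, Or.inl rfl⟩))).2
      (mem_filter.1 (hPU (mem_pairSupp.2 ⟨e, he, Or.inr rfl⟩))).2 hce)
  have hsplit := card_filter_add_card_filter_not (s := U) (fun i => h.cent M (s i) = c)
  simp only [ne_eq] at hcol
  obtain ⟨i₀, hi₀⟩ : (U.filter fun i => h.cent M (s i) = c).Nonempty := by
    rw [← card_pos]
    omega
  obtain ⟨hi₀U, hi₀c⟩ := mem_filter.1 hi₀
  have hi₀M := (mem_filter.1 hi₀U).2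
  have hV₀cent : #(V₀.filter fun i => s i ∉ h.cent M (s i₀)) ≤
      #(U.filter fun i => ¬ h.cent M (s i) = c) := by
    refine card_le_card fun i hi => ?_
    obtain ⟨hi, hic⟩ := mem_filter.1 hi
    refine mem_filter.2 ⟨mem_filter.2 ⟨hi, fun hiM => hic (h.map_le_cent _ hiM)⟩, fun hcc => ?_⟩
    rw [hi₀c, ← hcc] at hic
    exact hic (h.self_mem_cent _)
  by_cases hf : χ (s i₀) = 1
  · have h1 := card_filter_add_card_filter_not (s := V₀) (fun i => s i ∈ h.cent M (s i₀))
    have h2 : #(V₀.filter fun i => s i ∈ h.cent M (s i₀)) ≤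
        #(V.filter fun i => χ (s i) = 1) := by
      refine card_le_card fun i hi => ?_
      obtain ⟨hi, hic⟩ := mem_filter.1 hi
      exact mem_filter.2 ⟨hV₀V hi, h.cent_of_chi hf hi₀M hic⟩
    omega
  · have hmono := card_le_card (filter_subset_filter (fun i => χ (s i) = 1)
      (sdiff_subset : V \ W ⊆ V))
    have hmono' := card_le_card (filter_subset_filter (fun i => s i ∈ M.map ν)
      (sdiff_subset : V \ W ⊆ V))
    have hω : #((V \ W).filter fun i => s i ∉ h.cent M (s i₀)) ≤
        #(V₀.filter fun i => s i ∉ h.cent M (s i₀)) + #(pairSupp Y) := by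
      refine (card_le_card (fun i hi => ?_)).trans (card_union_le _ _)
      obtain ⟨hi, hic⟩ := mem_filter.1 hi
      by_cases hiY : i ∈ pairSupp Y
      · exact mem_union_right _ hiY
      · exact mem_union_left _ (mem_filter.2 ⟨mem_sdiff.2 ⟨hi, hiY⟩, hic⟩)
    obtain ⟨T, hT, hTc⟩ := h.exists_of_cent hM hf (by omega) hc hmax (hIH _ hf) (by omega)
      (fun hk => by have := hL1 hk; omega) (by omega)
    exact hno ⟨T, hT.trans sdiff_subset, hTc⟩

end

section
open scoped Classical
universe u v w

theorem exists_product_one_aux {p : ℕ} {ι : Type w} (m : ℕ) :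
    ∀ (G : Type u) (A : Type v) [Group G] [CommGroup A] [Finite A]
      (χ : G →* Multiplicative (ZMod p)) (ν : A →* G), FrobeniusExt p χ ν → Nat.card A = m →
      ∀ (s : ι → G) (V : Finset ι), #V + 2 = p * m + m + p →
        ∃ T ⊆ V, #T = p * m ∧ 1 ∈ famProds s T := by
  induction m using Nat.strong_induction_on with
  | _ m ih =>
    intro G A _ _ _ χ ν h hm s V hV
    subst hm
    by_cases hc : ClassBound χ s V
    swap
    · exact h.exists_of_not_classBound s V hV hc
    obtain ⟨M, W, hWV, hW, hcov, hcW, hmax⟩ := h.exists_maximal_covers s V hc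
    by_cases hM : M = ⊤
    · subst hM
      rw [Subgroup.card_top] at hW
      exact h.exists_of_covers_top s V W hWV hV hW hcov hcW
    · refine h.exists_of_maximal_covers hM hWV hV hW hcW (hmax.resolve_left hM) ?_
      intro f hf s' V' hV'
      refine ih (Nat.card M) ?_ (h.cent M f) M _ _ (h.sub M hf) rfl s' V' hV'
      refine lt_of_le_of_ne (Nat.le_of_dvd Nat.card_pos (Subgroup.card_subgroup_dvd_card M)) ?_
      intro hcard
      exact hM (Subgroup.eq_top_of_card_eq M hcard)

/-- A family of `p * |A| + |A| + p - 2` members of `G` has a product-one subfamily of length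
`|G| = p * |A|`. -/
theorem exists_product_one {p : ℕ} {ι G A : Type*} [Group G] [CommGroup A] [Finite A]
    {χ : G →* Multiplicative (ZMod p)} {ν : A →* G} (h : FrobeniusExt p χ ν) (s : ι → G)
    (V : Finset ι) (hV : #V + 2 = p * Nat.card A + Nat.card A + p) :
    ∃ T ⊆ V, #T = p * Nat.card A ∧ 1 ∈ famProds s T :=
  exists_product_one_aux _ G A χ ν h rfl s V hV

end
end FrobeniusExt

section
variable {p m r : ℕ} {G : Type*} [Group G] [Finite G] {x y : G}

theorem normal_zpowers_of_conj (hrel : x⁻¹ * y * x = y ^ r)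
    (hgen : Subgroup.closure ({x, y} : Set G) = ⊤) : (Subgroup.zpowers y).Normal := by
  rw [← Subgroup.normalizer_eq_top_iff, eq_top_iff, ← hgen, Subgroup.closure_le]
  rintro g (rfl | rfl)
  · rw [← inv_inv g]
    refine inv_mem (Subgroup.mem_normalizer_fintype ?_)
    rintro _ ⟨k, rfl⟩
    refine ⟨r * k, ?_⟩
    have h := conj_zpow (a := g⁻¹) (b := y) (i := k)
    rw [inv_inv, hrel] at h
    simp only [inv_inv]
    rw [← h, zpow_mul, zpow_natCast]
  · exact Subgroup.le_normalizer (Subgroup.mem_zpowers g)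

theorem eq_one_of_commute_of_conj (hp : p.Prime) (hr : 0 < r) (hcard : Nat.card G = p * m)
    (hm : 0 < m) (hoy : orderOf y = m) (hrel : x⁻¹ * y * x = y ^ r) (hgcd : (r - 1).Coprime m)
    {g n : G} (hg : g ∉ Subgroup.zpowers y) (hn : n ∈ Subgroup.zpowers y) (hc : g * n = n * g) :
    n = 1 := by
  classical
  have hindex : (Subgroup.zpowers y).index = p := by
    have h := Subgroup.card_mul_index (Subgroup.zpowers y)
    rw [Nat.card_zpowers, hoy, hcard, mul_comm p] at h
    exact Nat.eq_of_mul_eq_mul_left hm h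
  have hle : Subgroup.zpowers y ≤ Subgroup.centralizer {n} := by
    rw [Subgroup.zpowers_le, Subgroup.mem_centralizer_singleton_iff]
    obtain ⟨k, rfl⟩ := hn
    exact ((Commute.refl y).zpow_right k).eq
  have hmul := Subgroup.relIndex_mul_index hle
  rw [hindex] at hmul
  have htop : Subgroup.centralizer {n} = ⊤ := by
    rw [← Subgroup.index_eq_one]
    rcases (Nat.dvd_prime hp).1 (Dvd.intro_left _ hmul) with h | h
    · exact h
    · rw [h] at hmul
      have h1 : (Subgroup.zpowers y).relIndex (Subgroup.centralizer {n}) = 1 :=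
        Nat.eq_of_mul_eq_mul_right hp.pos (hmul.trans (one_mul p).symm)
      exact (hg (Subgroup.relIndex_eq_one.1 h1 (Subgroup.mem_centralizer_singleton_iff.2 hc))).elim
  have hx : x * n = n * x := by
    rw [← Subgroup.mem_centralizer_singleton_iff, htop]
    exact Subgroup.mem_top x
  obtain ⟨k, hk, rfl⟩ : ∃ k : ℕ, k < m ∧ y ^ k = n := by
    obtain ⟨k, hk, rfl⟩ := (isOfFinOrder_of_finite y).mem_zpowers_iff_mem_range_orderOf.1 hn
      |> Finset.mem_image.1
    exact ⟨k, by rw [← hoy]; exact Finset.mem_range.1 hk, rfl⟩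
  have h1 : y ^ (k * (r - 1)) = 1 := by
    have h := conj_pow (a := x⁻¹) (b := y) (i := k)
    rw [inv_inv, hrel, mul_assoc, ← hx, inv_mul_cancel_left, ← pow_mul] at h
    have h2 : r * k = k + k * (r - 1) := by
      obtain ⟨q, rfl⟩ := Nat.exists_eq_add_of_le hr
      rw [Nat.add_sub_cancel_left]
      ring
    rwa [h2, pow_add, mul_eq_left] at h
  have hdvd : m ∣ k := by
    rw [← hoy] at hgcd ⊢
    exact (hgcd.symm).dvd_of_dvd_mul_right (orderOf_dvd_of_pow_eq_one h1)
  rw [Nat.eq_zero_of_dvd_of_lt hdvd hk, pow_zero]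

theorem exists_frobeniusExt (hp : p.Prime) (hm : 0 < m) (hr : 0 < r)
    (hcard : Nat.card G = p * m) (hoy : orderOf y = m) (hrel : x⁻¹ * y * x = y ^ r)
    (hgen : Subgroup.closure ({x, y} : Set G) = ⊤)
    (hpmin : ∀ q : ℕ, q.Prime → q ∣ p * m → p ≤ q) (hgcd : Nat.gcd (p * (r - 1)) m = 1) :
    ∃ (χ : G →* Multiplicative (ZMod p)) (ν : Multiplicative (ZMod m) →* G),
      FrobeniusExt p χ ν ∧ χ x ≠ 1 ∧ χ y = 1 := by
  have := Fact.mk hp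
  have : NeZero m := ⟨hm.ne'⟩
  have hN := normal_zpowers_of_conj hrel hgen
  have hindex : Nat.card (G ⧸ Subgroup.zpowers y) = p := by
    have h := Subgroup.card_mul_index (Subgroup.zpowers y)
    rw [Nat.card_zpowers, hoy, hcard, mul_comm p] at h
    exact Nat.eq_of_mul_eq_mul_left hm h
  have hA : Nat.card (Multiplicative (ZMod m)) = m := by simp
  let φ : G ⧸ Subgroup.zpowers y ≃* Multiplicative (ZMod p) :=
    mulEquivOfPrimeCardEq hindex (by simp)
  let ψ : Multiplicative (ZMod m) ≃* Subgroup.zpowers y :=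
    mulEquivOfCyclicCardEq (by rw [hA, Nat.card_zpowers, hoy])
  let χ : G →* Multiplicative (ZMod p) :=
    φ.toMonoidHom.comp (QuotientGroup.mk' (Subgroup.zpowers y))
  let ν : Multiplicative (ZMod m) →* G := (Subgroup.zpowers y).subtype.comp ψ.toMonoidHom
  have hχ : ∀ g, χ g = 1 ↔ g ∈ Subgroup.zpowers y := by
    intro g
    rw [← QuotientGroup.eq_one_iff]
    exact φ.map_eq_one_iff
  have hχx : χ x ≠ 1 := by
    rw [ne_eq, hχ]
    intro hx
    have htop : Subgroup.zpowers y = ⊤ := by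
      rw [eq_top_iff, ← hgen, Subgroup.closure_le]
      rintro g (rfl | rfl)
      · exact hx
      · exact Subgroup.mem_zpowers g
    have h1 := Nat.card_zpowers y
    rw [htop, Subgroup.card_top, hoy, hcard] at h1
    have := hp.two_le
    nlinarith
  refine ⟨χ, ν, ⟨hp, ⟨x, hχx⟩, inferInstance, ?_, ?_, ?_, ?_⟩, hχx,
    (hχ y).2 (Subgroup.mem_zpowers y)⟩
  · exact (Subgroup.subtype_injective _).comp ψ.injective
  · intro g
    rw [hχ]
    constructor
    · intro hg
      exact ⟨ψ.symm ⟨g, hg⟩, by simp [ν]⟩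
    · rintro ⟨a, rfl⟩
      exact (ψ a).2
  · intro g a hg hc
    rw [ne_eq, hχ] at hg
    have h1 := eq_one_of_commute_of_conj hp hr hcard hm hoy hrel
      (Nat.Coprime.coprime_dvd_left (Dvd.intro_left p rfl) hgcd) hg (ψ a).2 hc
    exact ψ.map_eq_one_iff.1 (Subtype.ext h1)
  · intro q hq hq1
    rw [hA] at hq
    have h1 := hpmin _ (Nat.minFac_prime hq1)
      (((Nat.minFac_dvd q).trans hq).trans (Dvd.intro_left p rfl))
    refine lt_of_le_of_ne (h1.trans (Nat.minFac_le (Nat.pos_of_dvd_of_pos hq hm))) ?_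
    rintro rfl
    have h2 := Nat.dvd_gcd (Dvd.intro (r - 1) rfl) hq
    rw [hgcd] at h2
    exact hq1 (Nat.dvd_one.1 h2)

end

theorem exists_family {G : Type*} (S : Multiset G) :
    ∃ s : Fin (Multiset.card S) → G, (univ : Finset (Fin (Multiset.card S))).val.map s = S := by
  induction S using Quotient.inductionOn with
  | _ l => exact ⟨l.get, (Fin.univ_val_map l.get).trans (congrArg _ (List.ofFn_get l))⟩

section
variable {p : ℕ} {G : Type*} [Group G]

theorem mem_piSet_of_mem_famProds {ι : Type*} {s : ι → G} {T : Finset ι} {g : G}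
    (hg : g ∈ famProds s T) : g ∈ piSet (T.val.map s) := by
  obtain ⟨l, hl, rfl⟩ := hg
  exact ⟨l.map s, by rw [← hl, Multiset.map_coe], rfl⟩

/-- The entries of a product-one subsequence of `1 ^ a * y ^ b * x ^ c` are trivial if
`b < |y|` and `c < p`. -/
theorem eq_replicate_of_one_mem_piSet (hp : p.Prime) (χ : G →* Multiplicative (ZMod p)) {x y : G}
    (hx : χ x ≠ 1) (hy : χ y = 1) {a b c : ℕ} (hb : b < orderOf y) (hc : c < p)
    {T : Multiset G}
    (hT : T ≤ Multiset.replicate a 1 + Multiset.replicate b y + Multiset.replicate c x)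
    (h1 : 1 ∈ piSet T) : ∃ i ≤ a, T = Multiset.replicate i 1 := by
  classical
  have key : ∀ {S U V : Multiset G}, S ≤ U + V → ∃ U' ≤ U, ∃ V' ≤ V, S = U' + V' := by
    intro S U V h
    refine ⟨S ∩ U, Multiset.inter_le_right, S - U, ?_, ?_⟩
    · rw [Multiset.sub_le_iff_le_add, add_comm]
      exact h
    · rw [add_comm, Multiset.sub_add_inter]
  obtain ⟨T', hT', T₃, hT₃, rfl⟩ := key hT
  obtain ⟨T₁, hT₁, T₂, hT₂, rfl⟩ := key hT'
  obtain ⟨i, hi, rfl⟩ := Multiset.le_replicate_iff.1 hT₁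
  obtain ⟨j, hj, rfl⟩ := Multiset.le_replicate_iff.1 hT₂
  obtain ⟨k, hk, rfl⟩ := Multiset.le_replicate_iff.1 hT₃
  obtain ⟨l, hl, hl1⟩ := h1
  have hχ := congrArg χ hl1
  rw [map_list_prod, ← Multiset.prod_coe, ← Multiset.map_coe, hl] at hχ
  simp only [Multiset.map_add, Multiset.map_replicate, Multiset.prod_add, Multiset.prod_replicate,
    map_one, hy, one_pow, one_mul] at hχ
  have hord : orderOf (χ x) = p := by
    have := Fact.mk hp
    refine orderOf_eq_prime ?_ hx
    apply Multiplicative.toAdd.injective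
    rw [toAdd_pow, toAdd_one]
    simp
  have hk0 : k = 0 := by
    refine Nat.eq_zero_of_dvd_of_lt ?_ (lt_of_le_of_lt hk hc)
    rw [← hord]
    exact orderOf_dvd_of_pow_eq_one hχ
  subst hk0
  rw [Multiset.replicate_zero, add_zero] at hl
  have hperm : l.Perm (List.replicate i 1 ++ List.replicate j y) := by
    rw [← Multiset.coe_eq_coe, hl, ← Multiset.coe_add, Multiset.coe_replicate,
      Multiset.coe_replicate]
  have hmem : ∀ g ∈ l, g = 1 ∨ g = y := by
    intro g hg
    rw [hperm.mem_iff, List.mem_append] at hg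
    exact hg.imp List.eq_of_mem_replicate List.eq_of_mem_replicate
  have hprod := hperm.prod_eq' (List.pairwise_of_forall_mem_list fun g hg g' hg' => by
    rcases hmem g hg with rfl | rfl
    · exact Commute.one_left _
    · rcases hmem g' hg' with rfl | rfl
      · exact Commute.one_right _
      · exact Commute.refl _)
  rw [hl1, List.prod_append, List.prod_replicate, List.prod_replicate, one_pow, one_mul] at hprod
  have hj0 : j = 0 := Nat.eq_zero_of_dvd_of_lt (orderOf_dvd_of_pow_eq_one hprod.symm)
    (lt_of_le_of_lt hj hb)
  subst hj0
  exact ⟨i, hi, by simp⟩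

theorem FrobeniusExt.dG_eq {A : Type*} [CommGroup A] [Finite A] {χ : G →* Multiplicative (ZMod p)}
    {ν : A →* G} (h : FrobeniusExt p χ ν) {x y : G} (hx : χ x ≠ 1) (hy : χ y = 1)
    (hoy : orderOf y = Nat.card A) : dG G = Nat.card A + p - 2 := by
  have hA : 0 < Nat.card A := Nat.card_pos
  have hp := h.prime.two_le
  refine IsGreatest.csSup_eq ⟨?_, ?_⟩
  · refine ⟨Multiset.replicate 0 1 + Multiset.replicate (Nat.card A - 1) y +
      Multiset.replicate (p - 1) x, by simp; omega, ?_⟩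
    rintro ⟨T, hT, hT0, h1⟩
    obtain ⟨i, hi, rfl⟩ := eq_replicate_of_one_mem_piSet h.prime χ hx hy (by omega) (by omega) hT h1
    exact hT0 (by simp [Nat.le_zero.1 hi])
  · rintro n ⟨S, rfl, hS⟩
    by_contra hcon
    obtain ⟨s, hs⟩ := exists_family S
    obtain ⟨I, -, hI, h1⟩ := h.exists_nonempty_product_one s univ (by
      rw [card_univ, Fintype.card_fin]
      omega)
    refine hS ⟨I.val.map s, ?_, ?_, mem_piSet_of_mem_famProds h1⟩
    · conv_rhs => rw [← hs]
      exact Multiset.map_le_map (val_le_iff.2 (subset_univ I))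
    · rw [ne_eq, Multiset.map_eq_zero, val_eq_zero]
      exact hI.ne_empty

theorem FrobeniusExt.EG_eq [Fintype G] {A : Type*} [CommGroup A] [Finite A]
    {χ : G →* Multiplicative (ZMod p)} {ν : A →* G} (h : FrobeniusExt p χ ν) {x y : G}
    (hx : χ x ≠ 1) (hy : χ y = 1) (hoy : orderOf y = Nat.card A)
    (hcard : Fintype.card G = p * Nat.card A) :
    EG G = p * Nat.card A + Nat.card A + p - 2 := by
  have hA : 0 < Nat.card A := Nat.card_pos
  have hp := h.prime.two_le
  have hpA : 0 < p * Nat.card A := Nat.mul_pos h.prime.pos hA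
  refine IsLeast.csInf_eq ⟨?_, ?_⟩
  · intro S hS
    obtain ⟨s, hs⟩ := exists_family S
    obtain ⟨T, -, hT, h1⟩ := h.exists_product_one s univ (by
      rw [card_univ, Fintype.card_fin]
      omega)
    refine ⟨T.val.map s, ?_, ?_, mem_piSet_of_mem_famProds h1⟩
    · conv_rhs => rw [← hs]
      exact Multiset.map_le_map (val_le_iff.2 (subset_univ T))
    · rw [Multiset.card_map, card_val, hT, hcard]
  · intro t ht
    by_contra hcon
    let R : Multiset G := Multiset.replicate (p * Nat.card A - 1) 1 +
      Multiset.replicate (Nat.card A - 1) y + Multiset.replicate (p - 1) x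
    have hR : Multiset.card R = p * Nat.card A + Nat.card A + p - 3 := by
      simp only [R, Multiset.card_add, Multiset.card_replicate]
      omega
    obtain ⟨S, hSR, hS⟩ : ∃ S ≤ R, Multiset.card S = t := by
      obtain ⟨S, hS⟩ := Multiset.exists_mem_of_ne_zero (s := Multiset.powersetCard t R) (by
        rw [ne_eq, ← Multiset.card_eq_zero, Multiset.card_powersetCard]
        exact (Nat.choose_pos (by omega)).ne')
      exact ⟨S, Multiset.mem_powersetCard.1 hS⟩
    obtain ⟨T, hT, hTc, h1⟩ := ht S hS
    obtain ⟨i, hi, rfl⟩ := eq_replicate_of_one_mem_piSet h.prime χ hx hy (by omega) (by omega)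
      (hT.trans hSR) h1
    rw [Multiset.card_replicate, hcard] at hTc
    omega

end

end

theorem stmt_11 (p m r : ℕ) (G : Type*) [Group G] [Fintype G] (x y : G)
    (hp : p.Prime) (hm : 0 < m) (hr : 0 < r)
    (hcard : Fintype.card G = p * m)
    (hox : orderOf x = p) (hoy : orderOf y = m)
    (hrel : x⁻¹ * y * x = y ^ r)
    (hgen : Subgroup.closure ({x, y} : Set G) = ⊤)
    (hpmin : ∀ q : ℕ, q.Prime → q ∣ p * m → p ≤ q)
    (hgcd : Nat.gcd (p * (r - 1)) m = 1) :
    EG G = dG G + Fintype.card G ∧ EG G = p * m + m + p - 2 := by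
  have : NeZero m := ⟨hm.ne'⟩
  have hA : Nat.card (Multiplicative (ZMod m)) = m := by simp
  obtain ⟨χ, ν, h, hx, hy⟩ := exists_frobeniusExt hp hm hr
    (by rw [Nat.card_eq_fintype_card, hcard]) hoy hrel hgen hpmin hgcd
  have hE := h.EG_eq hx hy (by rw [hA, hoy]) (by rw [hA, hcard])
  have hd := h.dG_eq hx hy (by rw [hA, hoy])
  rw [hA] at hE hd
  have := hp.two_le
  exact ⟨by rw [hE, hd, hcard]; omega, hE⟩
end
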